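/- arXiv:1010.0260 — 3 statements merged into one kernel-verified Lean document; each statement's English description precedes it below -/
import Mathlib

section
/- Let ρ : SO(3) → SO(5) be the irreducible embedding given by the conjugation action of SO(3) on symmetric trace-free 3×3 matrices, written in the orthonormal basis e₁,...,e₅ of S²₀(ℝ³). For every continuous map f : S⁴ → SO(3) from the 4-sphere, the composition ρ ∘ f : S⁴ → SO(5) is null-homotopic, i.e. homotopic to a constant map. (Equivalently, the induced homomorphism (i_ir)_* : π₄(SO(3)) → π₄(SO(5)) is trivial.) -/
open Matrix

/-- `SO(n)`: real `n×n` orthogonal matrices of determinant one, with the subspace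
topology from the space of matrices. -/
abbrev SO (n : ℕ) : Type :=
  {A : Matrix (Fin n) (Fin n) ℝ // Aᵀ * A = 1 ∧ A.det = 1}

/-- The 4-sphere, as the unit sphere in `ℝ⁵`. -/
abbrev S4 : Type := Metric.sphere (0 : EuclideanSpace ℝ (Fin 5)) 1

/-- The identification `ℝ⁵ ≅ S²₀(ℝ³)`, `x ↦ X(x)`; the vectors `X(eᵢ)` form an
orthonormal basis of `S²₀(ℝ³)` for the inner product `⟨X,Y⟩ = (1/2)·tr(XY)`. -/
noncomputable def Xmat (x : Fin 5 → ℝ) : Matrix (Fin 3) (Fin 3) ℝ :=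
  !![x 0 / Real.sqrt 3 - x 4, x 3, x 1;
     x 3, x 0 / Real.sqrt 3 + x 4, x 2;
     x 1, x 2, -2 * x 0 / Real.sqrt 3]

/-- The irreducible embedding `ρ : SO(3) → SO(5)`: the matrix, in the orthonormal basis
`e₁,…,e₅` of `S²₀(ℝ³)`, of the conjugation action `X ↦ A X A⁻¹`; its `(k,l)` entry is
`⟨ρ(A) X(e_l), X(e_k)⟩ = (1/2)·tr(A·X(e_l)·A⁻¹·X(e_k))`. -/
noncomputable def rhoMat (A : Matrix (Fin 3) (Fin 3) ℝ) : Matrix (Fin 5) (Fin 5) ℝ :=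
  Matrix.of fun k l =>
    (1 / 2 : ℝ) * (A * Xmat (Pi.single l 1) * A⁻¹ * Xmat (Pi.single k 1)).trace

open scoped Quaternion

/-- The unit sphere of `ℝⁿ⁺¹`. -/
abbrev Sph (n : ℕ) : Type := Metric.sphere (0 : EuclideanSpace ℝ (Fin (n + 1))) 1

/-- The interval `[-1, 1]`, the height coordinate of a suspension. -/
abbrev Height : Type := Set.Icc (-1 : ℝ) 1

namespace Height

/-- The lower end of the height interval. -/
def bot : Height := ⟨-1, by norm_num, by norm_num⟩

/-- The upper end of the height interval. -/
def top : Height := ⟨1, by norm_num, by norm_num⟩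

@[simp] lemma coe_bot : (bot : ℝ) = -1 := rfl
@[simp] lemma coe_top : (top : ℝ) = 1 := rfl

lemma one_sub_sq_nonneg (t : Height) : 0 ≤ 1 - (t : ℝ) ^ 2 := by
  nlinarith [t.2.1, t.2.2]

lemma eq_bot_or_top_of_sq {t : Height} (h : 1 - (t : ℝ) ^ 2 = 0) : t = bot ∨ t = top := by
  have : ((t : ℝ) + 1) * (t - 1) = 0 := by linarith
  rcases mul_eq_zero.1 this with h | h
  · left; ext; simp; linarith
  · right; ext; simp; linarith

end Height

/-- A map on a cylinder is constant on each of the two ends. -/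
def EndConst {X Y : Type*} (A : X × Height → Y) : Prop :=
  ∀ x x', A (x, Height.bot) = A (x', Height.bot) ∧ A (x, Height.top) = A (x', Height.top)

/-- The vector of `ℝⁿ⁺²` with height `t` above the vector `z` of `ℝⁿ⁺¹`. -/
noncomputable def suspVec {n : ℕ} (z : EuclideanSpace ℝ (Fin (n + 1))) (t : ℝ) :
    EuclideanSpace ℝ (Fin (n + 2)) :=
  WithLp.toLp 2 (Fin.cons t (fun i => z i))

lemma norm_suspVec_sq {n : ℕ} (z : EuclideanSpace ℝ (Fin (n + 1))) (t : ℝ) :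
    ‖suspVec z t‖ ^ 2 = t ^ 2 + ‖z‖ ^ 2 := by
  rw [EuclideanSpace.norm_sq_eq, EuclideanSpace.norm_sq_eq, Fin.sum_univ_succ]
  simp [suspVec]

lemma suspVec_inj {n : ℕ} {z z' : EuclideanSpace ℝ (Fin (n + 1))} {t t' : ℝ}
    (h : suspVec z t = suspVec z' t') : z = z' ∧ t = t' := by
  constructor
  · ext i
    have := congrArg (fun v : EuclideanSpace ℝ (Fin (n + 2)) => v i.succ) h
    simpa [suspVec] using this
  · have := congrArg (fun v : EuclideanSpace ℝ (Fin (n + 2)) => v 0) h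
    simpa [suspVec] using this

lemma contDiff_suspVec {n : ℕ} :
    ContDiff ℝ 1 (fun w : EuclideanSpace ℝ (Fin (n + 1)) × ℝ => suspVec w.1 w.2) := by
  rw [contDiff_euclidean]
  intro i
  refine Fin.cases ?_ (fun j => ?_) i
  · simpa [suspVec] using contDiff_snd
  · simp only [suspVec, Fin.cons_succ]
    fun_prop

lemma smul_suspVec {n : ℕ} (c : ℝ) (z : EuclideanSpace ℝ (Fin (n + 1))) (t : ℝ) :
    c • suspVec z t = suspVec (c • z) (c * t) := by
  ext i
  refine Fin.cases ?_ (fun j => ?_) i <;> simp [suspVec]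

lemma norm_sph {n : ℕ} (x : Sph n) : ‖(x : EuclideanSpace ℝ (Fin (n + 1)))‖ = 1 := by
  simp

/-- The quotient map from the cylinder over the `n`-sphere to the `(n+1)`-sphere. -/
noncomputable def susp (n : ℕ) : C(Sph n × Height, Sph (n + 1)) where
  toFun w := ⟨suspVec (Real.sqrt (1 - (w.2 : ℝ) ^ 2) • (w.1 : EuclideanSpace ℝ (Fin (n + 1)))) w.2,
    by
      rw [mem_sphere_zero_iff_norm, ← sq_eq_sq₀ (norm_nonneg _) zero_le_one, norm_suspVec_sq,
        norm_smul, norm_sph, mul_one, Real.norm_eq_abs, sq_abs,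
        Real.sq_sqrt w.2.one_sub_sq_nonneg]
      ring⟩
  continuous_toFun := by
    refine Continuous.subtype_mk ?_ _
    exact contDiff_suspVec.continuous.comp (by fun_prop : Continuous fun w : Sph n × Height =>
      (Real.sqrt (1 - (w.2 : ℝ) ^ 2) • (w.1 : EuclideanSpace ℝ (Fin (n + 1))), (w.2 : ℝ)))

lemma coe_susp {n : ℕ} (x : Sph n) (t : Height) : (susp n (x, t) : EuclideanSpace ℝ (Fin (n + 2))) =
    suspVec (Real.sqrt (1 - (t : ℝ) ^ 2) • (x : EuclideanSpace ℝ (Fin (n + 1)))) t := rfl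

instance (n : ℕ) : Nonempty (Sph n) :=
  (NormedSpace.sphere_nonempty (x := (0 : EuclideanSpace ℝ (Fin (n + 1)))).2 zero_le_one).to_subtype

lemma susp_surjective (n : ℕ) : Function.Surjective (susp n) := by
  intro y
  set z : EuclideanSpace ℝ (Fin (n + 1)) := WithLp.toLp 2 (fun i => y.1 i.succ) with hz
  have hy : (y : EuclideanSpace ℝ (Fin (n + 2))) = suspVec z (y.1 0) := by
    ext i
    refine Fin.cases ?_ (fun j => ?_) i <;> simp [suspVec, hz]
  have hn : (y.1 0) ^ 2 + ‖z‖ ^ 2 = 1 := by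
    rw [← norm_suspVec_sq, ← hy, norm_sph, one_pow]
  have ht : y.1 0 ∈ Set.Icc (-1 : ℝ) 1 := by
    rw [Set.mem_Icc, ← abs_le, ← sq_le_one_iff_abs_le_one]
    nlinarith [sq_nonneg ‖z‖]
  have hs : Real.sqrt (1 - (y.1 0) ^ 2) = ‖z‖ := by
    rw [show 1 - (y.1 0) ^ 2 = ‖z‖ ^ 2 by linarith, Real.sqrt_sq (norm_nonneg _)]
  by_cases h0 : z = 0
  · obtain ⟨x⟩ := (inferInstance : Nonempty (Sph n))
    refine ⟨(x, ⟨_, ht⟩), Subtype.ext ?_⟩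
    rw [coe_susp, hs, h0, norm_zero, zero_smul, ← h0, ← hy]
  · refine ⟨(⟨‖z‖⁻¹ • z, by simp [norm_smul, h0]⟩, ⟨_, ht⟩), Subtype.ext ?_⟩
    rw [coe_susp, hs, smul_smul, mul_inv_cancel₀ (norm_ne_zero_iff.2 h0), one_smul, ← hy]

lemma susp_eq_susp {n : ℕ} {w w' : Sph n × Height} (h : susp n w = susp n w') :
    w = w' ∨ (w.2 = Height.bot ∧ w'.2 = Height.bot) ∨ (w.2 = Height.top ∧ w'.2 = Height.top) := by
  obtain ⟨x, t⟩ := w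
  obtain ⟨x', t'⟩ := w'
  obtain ⟨h1, h2⟩ := suspVec_inj (congrArg Subtype.val h)
  have h2 : t = t' := Subtype.ext h2
  subst h2
  by_cases h0 : 1 - (t : ℝ) ^ 2 = 0
  · rcases Height.eq_bot_or_top_of_sq h0 with h | h <;> simp [h]
  · left
    have : Real.sqrt (1 - (t : ℝ) ^ 2) ≠ 0 := fun h =>
      h0 ((Real.sqrt_eq_zero t.one_sub_sq_nonneg).1 h)
    exact Prod.ext (Subtype.ext (smul_right_injective _ this h1)) rfl

lemma EndConst.exists_factor {n : ℕ} {Y : Type*} [TopologicalSpace Y] (A : C(Sph n × Height, Y))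
    (hA : EndConst A) : ∃ a : C(Sph (n + 1), Y), ∀ w, a (susp n w) = A w := by
  have hq : Topology.IsQuotientMap (susp n) :=
    (susp n).continuous.isClosedMap.isQuotientMap (susp n).continuous (susp_surjective n)
  have hf : Function.FactorsThrough A (susp n) := by
    rintro ⟨x, t⟩ ⟨x', t'⟩ h
    rcases susp_eq_susp h with h | h | h
    · rw [h]
    · obtain ⟨rfl, rfl⟩ := h
      exact (hA x x').1
    · obtain ⟨rfl, rfl⟩ := h
      exact (hA x x').2
  exact ⟨hq.lift A hf, fun w => DFunLike.congr_fun (hq.lift_comp A hf) w⟩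

lemma endConst_comp_susp {n : ℕ} {Y : Type*} (a : Sph (n + 1) → Y) :
    EndConst fun w : Sph n × Height => a (susp n w) := by
  intro x x'
  constructor <;> refine congrArg a (Subtype.ext ?_) <;> simp [coe_susp]

lemma EndConst.exists_homotopy {n : ℕ} {Y : Type*} [TopologicalSpace Y]
    (H : C((Sph n × Height) × unitInterval, Y)) (hH : ∀ s, EndConst fun w => H (w, s)) :
    ∃ a₀ a₁ : C(Sph (n + 1), Y), (∀ w, a₀ (susp n w) = H (w, 0)) ∧
      (∀ w, a₁ (susp n w) = H (w, 1)) ∧ a₀.Homotopic a₁ := by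
  have hc : EndConst H.curry := by
    intro x x'
    constructor <;> ext s
    · exact (hH s x x').1
    · exact (hH s x x').2
  obtain ⟨a, ha⟩ := EndConst.exists_factor H.curry hc
  refine ⟨⟨fun x => a x 0, by fun_prop⟩, ⟨fun x => a x 1, by fun_prop⟩,
    fun w => by simp [ha], fun w => by simp [ha], ⟨⟨⟨fun w => a w.2 w.1, by fun_prop⟩, ?_, ?_⟩⟩⟩
  · intro x; rfl
  · intro x; rfl

/-- A continuous family of paths in `B` is obtained from its initial points by the action of a
continuous family of elements of `G`, provided that nearby points of `B` are related by elements of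
`G` depending continuously on them. -/
lemma exists_transport {G B X : Type*} [TopologicalSpace X] [CompactSpace X] [TopologicalSpace B]
    [Monoid G] [TopologicalSpace G] [ContinuousMul G] (P : G → B → B → Prop)
    (one : ∀ a, P 1 a a) (mul : ∀ g g' a b c, P g a b → P g' b c → P (g' * g) a c)
    (V : Set (B × B)) (hV : IsOpen V) (T : B × B → G) (hT : ContinuousOn T V)
    (hTP : ∀ w ∈ V, P (T w) w.1 w.2) (hdiag : ∀ a, (a, a) ∈ V ∧ T (a, a) = 1)
    (u : C(X × Height, B)) :
    ∃ r : C(X × Height, G), (∀ x, r (x, Height.bot) = 1) ∧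
      ∀ x t, P (r (x, t)) (u (x, Height.bot)) (u (x, t)) := by
  obtain ⟨δ, hδ, hu⟩ : ∃ δ > 0, ∀ x (t t' : Height), |(t : ℝ) - t'| < δ →
      (u (x, t), u (x, t')) ∈ V := by
    set K : Set (X × Height × Height) := {w | (u (w.1, w.2.1), u (w.1, w.2.2)) ∉ V} with hKdef
    have hK : IsCompact K := by
      have : IsClosed K := (hV.preimage (by fun_prop : Continuous fun w : X × Height × Height =>
        (u (w.1, w.2.1), u (w.1, w.2.2)))).isClosed_compl
      exact this.isCompact
    rcases K.eq_empty_or_nonempty with h0 | h0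
    · refine ⟨1, one_pos, fun x t t' _ => by_contra fun h => ?_⟩
      have : (x, t, t') ∈ K := h
      simp [h0] at this
    · obtain ⟨w, hw, hmin⟩ := hK.exists_isMinOn h0
        (by fun_prop : Continuous fun w : X × Height × Height =>
          |(w.2.1 : ℝ) - w.2.2|).continuousOn
      refine ⟨|(w.2.1 : ℝ) - w.2.2|, abs_pos.2 fun h => ?_, fun x t t' ht => by_contra fun h => ?_⟩
      · have h : w.2.1 = w.2.2 := Subtype.ext (sub_eq_zero.1 h)
        apply hw
        rw [h]
        exact (hdiag _).1
      · have : |(w.2.1 : ℝ) - w.2.2| ≤ |(t : ℝ) - t'| := hmin (a := (x, t, t')) h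
        linarith
  obtain ⟨N, hN⟩ := exists_nat_gt (2 / δ)
  have hN0 : (0 : ℝ) < N := lt_trans (by positivity) hN
  have h2N : 2 / (N : ℝ) < δ := by rwa [div_lt_comm₀ hN0 hδ]
  let c : ℕ → Height := fun i => Set.projIcc (-1) 1 (by norm_num) (-1 + i * (2 / N))
  have hc : ∀ i, |(c i : ℝ) - c (i + 1)| < δ := fun i => by
    refine lt_of_le_of_lt ?_ h2N
    refine (Set.abs_projIcc_sub_projIcc _).trans ?_
    rw [show (-1 + i * (2 / N) - (-1 + ((i + 1 : ℕ) : ℝ) * (2 / N)) : ℝ) = -(2 / N) by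
      push_cast; ring, abs_neg, abs_of_pos (by positivity)]
  have key : ∀ i : ℕ, ∃ r : C(X × Height, G), (∀ x, r (x, Height.bot) = 1) ∧
      ∀ x t, P (r (x, t)) (u (x, Height.bot)) (u (x, min t (c i))) := by
    intro i
    induction i with
    | zero =>
      refine ⟨1, fun _ => rfl, fun x t => ?_⟩
      have : min t (c 0) = Height.bot := by
        have h0 : c 0 = Height.bot := Subtype.ext (by simp [c, Set.projIcc])
        rw [h0]
        exact min_eq_right (Subtype.coe_le_coe.1 t.2.1)
      rw [this]
      exact one _
    | succ i ih =>
      obtain ⟨r, hr1, hr⟩ := ih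
      have hmem : ∀ x (t : Height), (u (x, min t (c i)), u (x, min t (c (i + 1)))) ∈ V := by
        intro x t
        apply hu
        have := abs_min_sub_min_le_max (t : ℝ) (c i) t (c (i + 1))
        rw [sub_self, abs_zero, max_eq_right (abs_nonneg _)] at this
        have hm : ∀ a b : Height, ((min a b : Height) : ℝ) = min (a : ℝ) b :=
          fun a b => Subtype.mono_coe _ |>.map_min
        rw [hm, hm]
        exact this.trans_lt (hc i)
      refine ⟨⟨fun w => T (u (w.1, min w.2 (c i)), u (w.1, min w.2 (c (i + 1)))) * r w,
        Continuous.mul (hT.comp_continuous (by fun_prop) fun w => hmem _ _) r.continuous⟩,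
        fun x => ?_, fun x t => ?_⟩
      · have hm : ∀ a : Height, min Height.bot a = Height.bot :=
          fun a => min_eq_left (Subtype.coe_le_coe.1 a.2.1)
        simp [hm, hr1, (hdiag _).2]
      · exact mul _ _ _ _ _ (hr x t) (hTP _ (hmem x t))
  obtain ⟨r, hr1, hr⟩ := key N
  refine ⟨r, hr1, fun x t => ?_⟩
  have : min t (c N) = t := by
    have h0 : c N = Height.top := Subtype.ext (by
      simp only [c, mul_div_cancel₀ (2 : ℝ) hN0.ne']
      norm_num [Set.projIcc])
    rw [h0]
    exact min_eq_left (Subtype.coe_le_coe.1 t.2.2)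
  simpa [this] using hr x t

instance (n : ℕ) : PreconnectedSpace (Sph (n + 1)) :=
  isPreconnected_iff_preconnectedSpace.1 <| isPreconnected_sphere (by
    rw [← Module.finrank_eq_rank, finrank_euclideanSpace, Fintype.card_fin]
    exact_mod_cast (by omega : 1 < n + 1 + 1)) _ _

/-- Nowhere zero complex functions on the 2-sphere have continuous logarithms. -/
lemma exists_log_sph_two (κ : C(Sph 2, ℂ)) (hκ : ∀ x, κ x ≠ 0) :
    ∃ l : C(Sph 2, ℂ), ∀ x, Complex.exp (l x) = κ x := by
  obtain ⟨r, hr1, hr⟩ := exists_transport (G := Multiplicative ℂ) (B := {z : ℂ // z ≠ 0})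
    (P := fun g a b => Complex.exp g.toAdd * a = b)
    (by simp)
    (by
      intro g g' a b c h h'
      rw [← h', ← h, toAdd_mul, Complex.exp_add, mul_assoc])
    {w | (w.2 / w.1 : ℂ) ∈ Complex.slitPlane}
    (Complex.isOpen_slitPlane.preimage (by
      apply Continuous.div (by fun_prop) (by fun_prop)
      exact fun w => w.1.2))
    (fun w => Multiplicative.ofAdd (Complex.log (w.2 / w.1)))
    (by
      refine continuous_ofAdd.comp_continuousOn (ContinuousOn.clog ?_ fun w hw => hw)
      exact (Continuous.div (by fun_prop) (by fun_prop) (fun w => w.1.2)).continuousOn)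
    (by
      intro w _
      rw [toAdd_ofAdd, Complex.exp_log (div_ne_zero w.2.2 w.1.2), div_mul_cancel₀ _ w.1.2])
    (by
      intro a
      simp [a.2])
    ⟨fun w : Sph 1 × Height => ⟨κ (susp 1 w), hκ _⟩, by fun_prop⟩
  simp only [ContinuousMap.coe_mk] at hr
  obtain ⟨x₀⟩ : Nonempty (Sph 1) := inferInstance
  let l₀ := Complex.log (κ (susp 1 (x₀, Height.bot)))
  have hends := endConst_comp_susp (n := 1) κ
  have hexp : ∀ x t, Complex.exp ((r (x, t)).toAdd + l₀) = κ (susp 1 (x, t)) := by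
    intro x t
    rw [Complex.exp_add, Complex.exp_log (hκ _), ← hr x t]
    exact congrArg _ (hends x₀ x).1
  have hconst : ∀ x x', r (x, Height.top) = r (x', Height.top) := by
    intro x x'
    have hz : ∀ y, ∃ n : ℤ, (r (y, Height.top)).toAdd =
        (r (x, Height.top)).toAdd + n * (2 * Real.pi * Complex.I) := by
      intro y
      have := (hexp y Height.top).trans ((hends y x).2.trans (hexp x Height.top).symm)
      obtain ⟨n, hn⟩ := Complex.exp_eq_exp_iff_exists_int.1 this
      exact ⟨n, by linear_combination hn⟩
    choose n hn using hz
    let φ : Sph 1 → ℝ := fun y =>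
      (((r (y, Height.top)).toAdd - (r (x, Height.top)).toAdd) / (2 * Real.pi * Complex.I)).re
    have hφ : ∀ y, φ y = n y := by
      intro y
      simp only [φ]
      rw [hn y, add_sub_cancel_left, mul_div_cancel_right₀ _ Complex.two_pi_I_ne_zero]
      simp
    have hφc : Continuous φ := by
      have h1 : Continuous fun y : Sph 1 => (r (y, Height.top)).toAdd :=
        continuous_toAdd.comp (by fun_prop)
      exact Complex.continuous_re.comp ((h1.sub continuous_const).div_const _)
    have hnc : Continuous n := by
      rw [Int.isClosedEmbedding_coe_real.isEmbedding.continuous_iff]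
      exact hφc.congr hφ
    have := PreconnectedSpace.constant inferInstance hnc (x := x') (y := x)
    have h1 : n x = 0 := by
      have h2 : φ x = 0 := by simp [φ]
      rw [hφ] at h2
      exact_mod_cast h2
    have h3 := hn x'
    rw [this, h1] at h3
    exact Multiplicative.toAdd.injective (by simpa using h3.symm)
  obtain ⟨l, hl⟩ := EndConst.exists_factor (n := 1)
    ⟨fun w => (r w).toAdd + l₀, (continuous_toAdd.comp r.continuous).add continuous_const⟩
    (fun x x' => by simp [hr1, hconst x x'])
  refine ⟨l, fun y => ?_⟩
  obtain ⟨⟨x, t⟩, rfl⟩ := susp_surjective 1 y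
  rw [hl]
  exact hexp x t

namespace Quaternion

/-- The imaginary unit `i` of the quaternions. -/
def unitI : ℍ[ℝ] := ⟨0, 1, 0, 0⟩

@[simp] lemma re_unitI : unitI.re = 0 := rfl
@[simp] lemma imI_unitI : unitI.imI = 1 := rfl
@[simp] lemma imJ_unitI : unitI.imJ = 0 := rfl
@[simp] lemma imK_unitI : unitI.imK = 0 := rfl

lemma unitI_mul_self : unitI * unitI = -1 := by
  ext <;> simp

/-- The imaginary unit `j` of the quaternions. -/
def unitJ : ℍ[ℝ] := ⟨0, 0, 1, 0⟩

@[simp] lemma re_unitJ : unitJ.re = 0 := rfl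
@[simp] lemma imI_unitJ : unitJ.imI = 0 := rfl
@[simp] lemma imJ_unitJ : unitJ.imJ = 1 := rfl
@[simp] lemma imK_unitJ : unitJ.imK = 0 := rfl

lemma unitJ_mul_self : unitJ * unitJ = -1 := by
  ext <;> simp

/-- The imaginary unit `k` of the quaternions. -/
def unitK : ℍ[ℝ] := ⟨0, 0, 0, 1⟩

@[simp] lemma re_unitK : unitK.re = 0 := rfl
@[simp] lemma imI_unitK : unitK.imI = 0 := rfl
@[simp] lemma imJ_unitK : unitK.imJ = 0 := rfl
@[simp] lemma imK_unitK : unitK.imK = 1 := rfl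

lemma unitK_mul_self : unitK * unitK = -1 := by
  ext <;> simp

/-- The rotation matrix of `v ↦ q v q⁻¹` on imaginary quaternions. -/
noncomputable def rot (q : ℍ[ℝ]) : Matrix (Fin 3) (Fin 3) ℝ :=
  (normSq q)⁻¹ • !![q.re ^ 2 + q.imI ^ 2 - q.imJ ^ 2 - q.imK ^ 2,
      2 * (q.imI * q.imJ - q.re * q.imK), 2 * (q.imI * q.imK + q.re * q.imJ);
    2 * (q.imI * q.imJ + q.re * q.imK),
      q.re ^ 2 - q.imI ^ 2 + q.imJ ^ 2 - q.imK ^ 2, 2 * (q.imJ * q.imK - q.re * q.imI);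
    2 * (q.imI * q.imK - q.re * q.imJ), 2 * (q.imJ * q.imK + q.re * q.imI),
      q.re ^ 2 - q.imI ^ 2 - q.imJ ^ 2 + q.imK ^ 2]

lemma rot_mul (p q : ℍ[ℝ]) : rot (p * q) = rot p * rot q := by
  rw [rot, rot, rot, smul_mul_smul_comm, map_mul, mul_inv]
  congr 1
  ext i j
  fin_cases i <;> fin_cases j <;>
    simp [Matrix.mul_apply, Fin.sum_univ_three] <;> ring

lemma normSq_pos {q : ℍ[ℝ]} (hq : q ≠ 0) : 0 < normSq q :=
  lt_of_le_of_ne normSq_nonneg (Ne.symm (normSq_ne_zero.2 hq))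

lemma rot_transpose_mul_rot {q : ℍ[ℝ]} (hq : q ≠ 0) : (rot q)ᵀ * rot q = 1 := by
  have h := (normSq_pos hq).ne'
  rw [rot, transpose_smul, smul_mul_smul_comm, ← mul_inv]
  rw [inv_smul_eq_iff₀ (mul_ne_zero h h), normSq_def']
  ext i j
  fin_cases i <;> fin_cases j <;>
    simp [Matrix.mul_apply, Fin.sum_univ_three] <;> ring

lemma det_rot {q : ℍ[ℝ]} (hq : q ≠ 0) : (rot q).det = 1 := by
  have h := (normSq_pos hq).ne'
  rw [rot, det_smul, Fintype.card_fin, inv_pow, inv_mul_eq_iff_eq_mul₀ (pow_ne_zero _ h),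
    normSq_def', det_fin_three]
  simp
  ring

lemma continuousOn_rot : ContinuousOn rot {0}ᶜ := by
  have hre := continuous_re
  have hi := continuous_imI
  have hj := continuous_imJ
  have hk := continuous_imK
  refine ContinuousOn.smul (continuous_normSq.continuousOn.inv₀ fun q hq =>
    normSq_ne_zero.2 hq) (Continuous.continuousOn ?_)
  refine continuous_matrix fun i j => ?_
  fin_cases i <;> fin_cases j <;> simp <;> fun_prop

/-- A quaternion over a rotation matrix of trace different from `-1`. -/
noncomputable def ofRot (h : Matrix (Fin 3) (Fin 3) ℝ) : ℍ[ℝ] :=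
  ⟨(1 + h.trace) / 4, (h 2 1 - h 1 2) / 4, (h 0 2 - h 2 0) / 4, (h 1 0 - h 0 1) / 4⟩

lemma cofactor_relations (h : SO 3) :
    h.1ᵀ = h.1.adjugate ∧ h.1 * h.1ᵀ = 1 := by
  have h1 : h.1 * h.1ᵀ = 1 := mul_eq_one_comm.1 h.2.1
  refine ⟨?_, h1⟩
  calc h.1ᵀ = h.1.adjugate * h.1 * h.1ᵀ := by rw [adjugate_mul, h.2.2, one_smul, one_mul]
    _ = h.1.adjugate := by rw [mul_assoc, h1, mul_one]

lemma rot_ofRot (h : SO 3) (ht : h.1.trace ≠ -1) : ofRot h.1 ≠ 0 ∧ rot (ofRot h.1) = h.1 := by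
  have h0 : ofRot h.1 ≠ 0 := fun h0 => ht (by
    have := congrArg (fun q : ℍ[ℝ] => q.re) h0
    simp only [ofRot, re_zero] at this
    linarith)
  refine ⟨h0, ?_⟩
  have hn := (normSq_pos h0).ne'
  obtain ⟨hadj, hmul⟩ := cofactor_relations h
  have hmul' := h.2.1
  rw [rot, inv_smul_eq_iff₀ hn, normSq_def']
  clear hn h0 ht
  generalize h.1 = m at *
  simp only [adjugate_fin_three, ← Matrix.ext_iff, Fin.forall_fin_succ, Matrix.mul_apply,
    Fin.sum_univ_three, transpose_apply] at hadj hmul hmul'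
  simp [Matrix.one_apply] at hadj hmul hmul'
  ext i j
  fin_cases i <;> fin_cases j <;>
    simp [ofRot, Matrix.trace, Fin.sum_univ_three] <;> grind

lemma rot_smul {c : ℝ} (hc : c ≠ 0) (q : ℍ[ℝ]) : rot (c • q) = rot q := by
  rw [rot, rot, normSq_smul, mul_inv, mul_smul, smul_comm, eq_comm]
  congr 1
  rw [eq_inv_smul_iff₀ (pow_ne_zero 2 hc)]
  ext i j
  fin_cases i <;> fin_cases j <;> simp <;> ring

lemma rot_one : rot 1 = 1 := by
  rw [rot]
  ext i j
  fin_cases i <;> fin_cases j <;> simp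

lemma normSq_inv_norm_smul {q : ℍ[ℝ]} (hq : q ≠ 0) : normSq (‖q‖⁻¹ • q) = 1 := by
  have := norm_ne_zero_iff.2 hq
  rw [normSq_eq_norm_mul_self, norm_smul, norm_inv, norm_norm, inv_mul_cancel₀ this, one_mul]

lemma exists_rot_eq (h : SO 3) : ∃ q : ℍ[ℝ], normSq q = 1 ∧ rot q = h.1 := by
  suffices ∃ q : ℍ[ℝ], q ≠ 0 ∧ rot q = h.1 by
    obtain ⟨q, hq, hr⟩ := this
    exact ⟨‖q‖⁻¹ • q, normSq_inv_norm_smul hq,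
      (rot_smul (inv_ne_zero (norm_ne_zero_iff.2 hq)) q).trans hr⟩
  have key : ∀ u : ℍ[ℝ], u * u = -1 → (h.1 * rot u).trace ≠ -1 →
      ∃ q : ℍ[ℝ], q ≠ 0 ∧ rot q = h.1 := by
    intro u hu ht
    have hu0 : u ≠ 0 := by
      rintro rfl
      simp at hu
    obtain ⟨h0, hr⟩ := rot_ofRot ⟨h.1 * rot u, by
      rw [transpose_mul, mul_assoc, ← mul_assoc h.1ᵀ, h.2.1, one_mul, rot_transpose_mul_rot hu0],
      by rw [det_mul, h.2.2, det_rot hu0, one_mul]⟩ ht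
    refine ⟨ofRot (h.1 * rot u) * u, mul_ne_zero h0 hu0, ?_⟩
    rw [rot_mul, hr, mul_assoc, ← rot_mul, hu, ← neg_one_smul ℝ (1 : ℍ[ℝ]),
      rot_smul (by norm_num), rot_one, mul_one]
  by_cases h1 : h.1.trace ≠ -1
  · exact ⟨_, rot_ofRot h h1⟩
  by_cases hi : (h.1 * rot unitI).trace ≠ -1
  · exact key _ unitI_mul_self hi
  by_cases hj : (h.1 * rot unitJ).trace ≠ -1
  · exact key _ unitJ_mul_self hj
  refine key unitK unitK_mul_self fun hk => ?_
  simp [rot, normSq_def', Matrix.trace, Fin.sum_univ_three, Matrix.mul_apply] at h1 hi hj hk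
  linarith

lemma eq_one_or_neg_one_of_rot_eq_one {q : ℍ[ℝ]} (hq : normSq q = 1) (h : rot q = 1) :
    q = 1 ∨ q = -1 := by
  have h0 := congrFun (congrFun h 0) 0
  have h1 := congrFun (congrFun h 1) 1
  simp [rot, hq] at h0 h1
  rw [normSq_def'] at hq
  have hi : q.imI = 0 := by nlinarith [sq_nonneg q.imI, sq_nonneg q.imJ, sq_nonneg q.imK]
  have hj : q.imJ = 0 := by nlinarith [sq_nonneg q.imI, sq_nonneg q.imJ, sq_nonneg q.imK]
  have hk : q.imK = 0 := by nlinarith [sq_nonneg q.imI, sq_nonneg q.imJ, sq_nonneg q.imK]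
  have hr : q.re ^ 2 = 1 := by simpa [hi, hj, hk] using hq
  rcases mul_self_eq_one_iff.1 ((sq _).symm.trans hr) with h | h
  · left; ext <;> simp [h, hi, hj, hk]
  · right; ext <;> simp [h, hi, hj, hk]

lemma continuous_ofRot : Continuous ofRot := by
  have : Continuous fun h : Matrix (Fin 3) (Fin 3) ℝ => (linearIsometryEquivTuple.symm
    (WithLp.toLp 2 ![(1 + h.trace) / 4, (h 2 1 - h 1 2) / 4, (h 0 2 - h 2 0) / 4,
      (h 1 0 - h 0 1) / 4]) : ℍ[ℝ]) := by
    refine linearIsometryEquivTuple.symm.continuous.comp ?_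
    refine (PiLp.continuous_toLp 2 _).comp (continuous_pi fun i => ?_)
    fin_cases i <;> simp [Matrix.trace, Fin.sum_univ_three] <;> fun_prop
  refine this.congr fun h => ?_
  ext <;> simp [ofRot]

lemma ofRot_one : ofRot 1 = 1 := by
  ext <;> simp [ofRot]
  norm_num

/-- Maps from the 4-sphere to `SO(3)` lift to the unit quaternions. -/
lemma exists_lift_rot (f : C(Sph 4, SO 3)) :
    ∃ F : C(Sph 4, ℍ[ℝ]), (∀ x, normSq (F x) = 1) ∧ ∀ x, rot (F x) = (f x).1 := by
  obtain ⟨r, hr1, hr⟩ := exists_transport (G := ℍ[ℝ]) (B := SO 3)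
    (P := fun g a b => normSq g = 1 ∧ rot g * a.1 = b.1)
    (by simp [rot_one])
    (by
      rintro g g' a b c ⟨h1, h2⟩ ⟨h1', h2'⟩
      refine ⟨by rw [map_mul, h1, h1', one_mul], ?_⟩
      rw [rot_mul, mul_assoc, h2, h2'])
    {w | (w.2.1 * w.1.1ᵀ).trace ≠ -1}
    (by
      refine isOpen_ne_fun ?_ continuous_const
      fun_prop)
    (fun w => ‖ofRot (w.2.1 * w.1.1ᵀ)‖⁻¹ • ofRot (w.2.1 * w.1.1ᵀ))
    (by
      have hc : Continuous fun w : SO 3 × SO 3 => ofRot (w.2.1 * w.1.1ᵀ) :=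
        continuous_ofRot.comp (by fun_prop)
      refine ContinuousOn.smul (hc.norm.continuousOn.inv₀ fun w hw => ?_) hc.continuousOn
      exact norm_ne_zero_iff.2 (rot_ofRot ⟨w.2.1 * w.1.1ᵀ, by
        simp [mul_assoc, ← mul_assoc w.2.1ᵀ, w.2.2.1, (cofactor_relations w.1).2], by
        simp [w.2.2.2, w.1.2.2]⟩ hw).1)
    (by
      intro w hw
      obtain ⟨h0, h1⟩ := rot_ofRot ⟨w.2.1 * w.1.1ᵀ, by
        simp [mul_assoc, ← mul_assoc w.2.1ᵀ, w.2.2.1, (cofactor_relations w.1).2], by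
        simp [w.2.2.2, w.1.2.2]⟩ hw
      refine ⟨normSq_inv_norm_smul h0, ?_⟩
      rw [rot_smul (inv_ne_zero (norm_ne_zero_iff.2 h0)), h1, mul_assoc, w.1.2.1, mul_one])
    (by
      intro a
      refine ⟨?_, ?_⟩
      · simp only [Set.mem_ofPred_eq, (cofactor_relations a).2, trace_one, Fintype.card_fin]
        norm_num
      · simp [(cofactor_relations a).2, ofRot_one])
    ((f.comp (susp 3)) : C(Sph 3 × Height, SO 3))
  obtain ⟨x₀⟩ : Nonempty (Sph 3) := inferInstance
  obtain ⟨q₀, hq₀, hq₀'⟩ := exists_rot_eq (f (susp 3 (x₀, Height.bot)))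
  have hends := endConst_comp_susp (n := 3) f
  have hrot : ∀ x t, rot (r (x, t) * q₀) = (f (susp 3 (x, t))).1 := by
    intro x t
    rw [rot_mul, hq₀']
    have := (hr x t).2
    simp only [ContinuousMap.comp_apply] at this
    rw [← this]
    exact congrArg (fun h : SO 3 => rot (r (x, t)) * h.1) (hends x₀ x).1
  have hconst : ∀ x x', r (x, Height.top) = r (x', Height.top) := by
    have h1 : r (x₀, Height.top) * star (r (x₀, Height.top)) = 1 := by
      rw [self_mul_star, (hr _ _).1, coe_one]
    have hsq : ∀ x, r (x, Height.top) * star (r (x₀, Height.top)) = 1 ∨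
        r (x, Height.top) * star (r (x₀, Height.top)) = -1 := by
      intro x
      have hn : q₀ * star q₀ = 1 := by rw [self_mul_star, hq₀, coe_one]
      refine eq_one_or_neg_one_of_rot_eq_one ?_ ?_
      · rw [map_mul, normSq_star, (hr _ _).1, (hr _ _).1, one_mul]
      · have h2 : rot (r (x, Height.top)) = rot (r (x₀, Height.top)) := by
          have h3 := (hrot x Height.top).trans
            ((congrArg Subtype.val (hends x x₀).2).trans (hrot x₀ Height.top).symm)
          have h4 := congrArg (fun m => m * rot (star q₀)) h3
          simpa only [← rot_mul, mul_assoc, hn, mul_one] using h4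
        rw [rot_mul, h2, ← rot_mul, h1, rot_one]
    have hre : ∀ x, r (x, Height.top) = r (x₀, Height.top) := by
      intro x
      have hc : Continuous fun x => (r (x, Height.top) * star (r (x₀, Height.top))).re :=
        continuous_re.comp (by fun_prop)
      have hor := (isPreconnected_univ (α := Sph 3)).eq_one_or_eq_neg_one_of_sq_eq
        hc.continuousOn (fun x _ => by
          simp only [Pi.pow_apply]
          rcases hsq x with h | h <;> rw [h] <;> simp)
      have h2 : star (r (x₀, Height.top)) * r (x₀, Height.top) = 1 := by
        rw [star_mul_self, (hr _ _).1, coe_one]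
      have hx : r (x, Height.top) * star (r (x₀, Height.top)) = 1 := by
        rcases hsq x with h | h
        · exact h
        · exfalso
          rcases hor with h' | h'
          · have := h' (Set.mem_univ x)
            norm_num [h] at this
          · have := h' (Set.mem_univ x₀)
            norm_num [h1] at this
      simpa [mul_assoc, h2] using congrArg (fun q => q * r (x₀, Height.top)) hx
    exact fun x x' => (hre x).trans (hre x').symm
  obtain ⟨F, hF⟩ := EndConst.exists_factor (n := 3)
    ⟨fun w => r w * q₀, r.continuous.mul continuous_const⟩
    (fun x x' => by simp [hr1, hconst x x'])
  refine ⟨F, fun y => ?_, fun y => ?_⟩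
  all_goals
    obtain ⟨⟨x, t⟩, rfl⟩ := susp_surjective 3 y
    rw [hF]
  · simp [(hr x t).1, hq₀]
  · exact hrot x t

lemma exists_mul_unitI_eq {a : ℍ[ℝ]} (ha : a * a = -1) : ∃ g : ℍ[ℝ], g ≠ 0 ∧ g * unitI = a * g := by
  by_cases h : 1 - a * unitI = 0
  · refine ⟨unitJ, fun h => by simpa using congrArg (fun q : ℍ[ℝ] => q.imJ) h, ?_⟩
    have : a = -unitI := by
      have h1 : a * unitI = 1 := (sub_eq_zero.1 h).symm
      have h2 : a * unitI * unitI = unitI := by rw [h1, one_mul]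
      rw [mul_assoc, unitI_mul_self, mul_neg_one] at h2
      rw [← h2, neg_neg]
    rw [this]
    ext <;> simp
  · refine ⟨_, h, ?_⟩
    rw [sub_mul, mul_sub, mul_assoc, unitI_mul_self, ← mul_assoc, ha]
    simp [add_comm]

/-- Maps from the 3-sphere to the imaginary unit quaternions lift through the Hopf fibration. -/
lemma exists_hopf_lift (u : C(Sph 3, ℍ[ℝ])) (hu : ∀ x, u x * u x = -1) :
    ∃ q : C(Sph 3, ℍ[ℝ]), ∀ x, q x ≠ 0 ∧ q x * unitI = u x * q x := by
  obtain ⟨r, hr1, hr⟩ := exists_transport (G := ℍ[ℝ]) (B := {a : ℍ[ℝ] // a * a = -1})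
    (P := fun g a b => g ≠ 0 ∧ g * a.1 = b.1 * g)
    (by simp)
    (by
      rintro g g' a b c ⟨h1, h2⟩ ⟨h1', h2'⟩
      exact ⟨mul_ne_zero h1' h1, by rw [mul_assoc, h2, ← mul_assoc, h2', mul_assoc]⟩)
    {w | 1 - w.2.1 * w.1.1 ≠ 0}
    (isOpen_ne_fun (by fun_prop) continuous_const)
    (fun w => (2 : ℝ)⁻¹ • (1 - w.2.1 * w.1.1))
    (by
      apply Continuous.continuousOn
      fun_prop)
    (by
      intro w hw
      refine ⟨smul_ne_zero (by norm_num) hw, ?_⟩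
      rw [smul_mul_assoc, mul_smul_comm, sub_mul, mul_sub, mul_assoc, w.1.2, ← mul_assoc, w.2.2]
      simp [add_comm])
    (by
      intro a
      have h2 : (1 : ℍ[ℝ]) - a.1 * a.1 = (2 : ℝ) • 1 := by
        rw [a.2, sub_neg_eq_add, two_smul]
      refine ⟨?_, ?_⟩
      · simp only [Set.mem_ofPred_eq, h2]
        exact smul_ne_zero two_ne_zero one_ne_zero
      · rw [h2, inv_smul_smul₀ two_ne_zero])
    ⟨fun w : Sph 2 × Height => ⟨u (susp 2 w), hu _⟩, by fun_prop⟩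
  simp only [ContinuousMap.coe_mk] at hr
  obtain ⟨x₀⟩ : Nonempty (Sph 2) := inferInstance
  have hends := endConst_comp_susp (n := 2) u
  obtain ⟨g₀, hg₀, hg₀'⟩ := exists_mul_unitI_eq (hu (susp 2 (x₀, Height.bot)))
  have hq : ∀ x t, r (x, t) * g₀ ≠ 0 ∧
      r (x, t) * g₀ * unitI = u (susp 2 (x, t)) * (r (x, t) * g₀) := by
    intro x t
    refine ⟨mul_ne_zero (hr x t).1 hg₀, ?_⟩
    rw [mul_assoc, hg₀', ← mul_assoc, ← mul_assoc, ← (hr x t).2]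
    exact congrArg (fun a => r (x, t) * a * g₀) (hends x₀ x).1
  set g₁ := r (x₀, Height.top) * g₀ with hg₁
  have hg₁0 : g₁ ≠ 0 := (hq _ _).1
  let κ : Sph 2 → ℍ[ℝ] := fun x => g₁⁻¹ * (r (x, Height.top) * g₀)
  have hκc : Continuous κ := by fun_prop
  have hκI : ∀ x, κ x * unitI = unitI * κ x := by
    intro x
    have h1 : g₁⁻¹ * u (susp 2 (x₀, Height.top)) = unitI * g₁⁻¹ := by
      rw [inv_mul_eq_iff_eq_mul₀ hg₁0, ← mul_assoc, (hq x₀ Height.top).2, mul_assoc,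
        mul_inv_cancel₀ hg₁0, mul_one]
    simp only [κ]
    rw [mul_assoc, (hq x _).2, ← mul_assoc unitI, ← h1, mul_assoc]
    exact congrArg (fun a => g₁⁻¹ * (a * (r (x, Height.top) * g₀))) (hends x x₀).2
  have hκ0 : ∀ x, κ x ≠ 0 := fun x => mul_ne_zero (inv_ne_zero hg₁0) (hq x _).1
  let k : C(Sph 2, ℂ) := ⟨fun x => ⟨(κ x).re, (κ x).imI⟩, by
    have h1 : Continuous fun x => ((κ x).re : ℂ) + (κ x).imI * Complex.I := by
      have := continuous_re.comp hκc
      have := continuous_imI.comp hκc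
      fun_prop
    refine h1.congr fun x => ?_
    apply Complex.ext <;> simp⟩
  have hk : ∀ x, (k x : ℍ[ℝ]) = κ x := by
    intro x
    have hJ := congrArg (fun q : ℍ[ℝ] => q.imK) (hκI x)
    have hK := congrArg (fun q : ℍ[ℝ] => q.imJ) (hκI x)
    simp at hJ hK
    ext <;> simp [k] <;> linarith
  obtain ⟨l, hl⟩ := exists_log_sph_two k fun x h => hκ0 x (by rw [← hk, h, coeComplex_zero])
  let e : Sph 2 × Height → ℂ := fun w => Complex.exp (-((1 + w.2.1) / 2 : ℝ) * l w.1)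
  have hec : Continuous e := by fun_prop
  have hcc : Continuous fun z : ℂ => (z : ℍ[ℝ]) :=
    (ofComplex.toLinearMap).continuous_of_finiteDimensional
  have hcI : ∀ z : ℂ, (z : ℍ[ℝ]) * unitI = unitI * (z : ℍ[ℝ]) := by
    intro z
    ext <;> simp
  obtain ⟨q, hqe⟩ := EndConst.exists_factor (n := 2)
    ⟨fun w => r w * g₀ * (e w : ℍ[ℝ]), (by fun_prop)⟩ (by
      have hb : ∀ x, r (x, Height.bot) * g₀ * (e (x, Height.bot) : ℍ[ℝ]) = g₀ := by
        intro x
        simp [e, hr1]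
      have ht : ∀ x, r (x, Height.top) * g₀ * (e (x, Height.top) : ℍ[ℝ]) = g₁ := by
        intro x
        have h1 : r (x, Height.top) * g₀ = g₁ * (k x : ℍ[ℝ]) := by
          rw [hk, mul_inv_cancel_left₀ hg₁0]
        have h2 : e (x, Height.top) = (k x)⁻¹ := by
          rw [← hl, ← Complex.exp_neg]
          simp [e]
        have h3 : k x ≠ 0 := by
          rw [← hl]
          exact Complex.exp_ne_zero _
        rw [h1, h2, mul_assoc, ← coeComplex_mul, mul_inv_cancel₀ h3, coeComplex_one, mul_one]
      intro x x'
      simp [hb, ht])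
  refine ⟨q, fun y => ?_⟩
  obtain ⟨⟨x, t⟩, rfl⟩ := susp_surjective 2 y
  rw [hqe, ContinuousMap.coe_mk]
  refine ⟨mul_ne_zero (hq x t).1 ((map_ne_zero ofComplex).2 (Complex.exp_ne_zero _)), ?_⟩
  rw [mul_assoc, hcI, ← mul_assoc, (hq x t).2, mul_assoc]

end Quaternion

lemma dimH_image_le_finrank {E E' : Type*} [NormedAddCommGroup E] [NormedSpace ℝ E]
    [FiniteDimensional ℝ E] [NormedAddCommGroup E'] [NormedSpace ℝ E'] {f : E → E'} {s : Set E}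
    (hf : ∀ x ∈ s, ContDiffAt ℝ 1 f x) : dimH (f '' s) ≤ Module.finrank ℝ E := by
  refine (dimH_image_le_of_locally_lipschitzOn fun x hx => ?_).trans
    ((dimH_mono (Set.subset_univ s)).trans (Real.dimH_univ_eq_finrank E).le)
  obtain ⟨C, t, ht, h⟩ := (hf x hx).exists_lipschitzOnWith
  exact ⟨C, t, mem_nhdsWithin_of_mem_nhds ht, h⟩

/-- A continuous map on the sphere to a finite-dimensional space is close to a smooth map. -/
lemma exists_contDiff_near (F : C(Sph 4, ℍ[ℝ])) (hF : ∀ x, F x ≠ 0) :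
    ∃ f : EuclideanSpace ℝ (Fin 5) → ℍ[ℝ], ContDiff ℝ 1 f ∧ ∀ x : Sph 4, ‖f x - F x‖ < ‖F x‖ := by
  obtain ⟨x₀, hx₀⟩ := isCompact_univ.exists_isMinOn (Set.univ_nonempty (α := Sph 4))
    (by fun_prop : Continuous fun x => ‖F x‖).continuousOn
  have : TietzeExtension ℍ[ℝ] := TietzeExtension.of_tvs ℝ
  obtain ⟨F', hF'⟩ := ContinuousMap.exists_extension
    (Metric.isClosed_sphere (x := (0 : EuclideanSpace ℝ (Fin 5))) (ε := 1)).isClosedEmbedding_subtypeVal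
    F
  obtain ⟨f, hf, hfd, -⟩ := Continuous.exists_contDiff_approx (f := F') (ε := fun _ => ‖F x₀‖) 1
    F'.continuous continuous_const (fun _ => norm_pos_iff.2 (hF x₀))
  refine ⟨f, hf, fun x => ?_⟩
  have h1 : F' x = F x := DFunLike.congr_fun hF' x
  rw [← h1, ← dist_eq_norm]
  refine (hfd x).trans_le ?_
  rw [h1]
  exact hx₀.2 (Set.mem_univ x)

lemma suspVec_ne_zero {n : ℕ} {z : EuclideanSpace ℝ (Fin (n + 1))} (hz : z ≠ 0) (t : ℝ) :
    suspVec z t ≠ 0 := by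
  intro h
  have h1 := norm_suspVec_sq z t
  rw [h, norm_zero] at h1
  have := norm_pos_iff.2 hz
  nlinarith [sq_nonneg t]

/-- The degree one homogeneous extension of a map on the unit sphere. -/
noncomputable def homExt (f : EuclideanSpace ℝ (Fin 5) → ℍ[ℝ]) (x : EuclideanSpace ℝ (Fin 5)) :
    ℍ[ℝ] := ‖x‖ • f (‖x‖⁻¹ • x)

lemma homExt_smul (f : EuclideanSpace ℝ (Fin 5) → ℍ[ℝ]) {c : ℝ} (hc : 0 < c)
    (x : EuclideanSpace ℝ (Fin 5)) : homExt f (c • x) = c • homExt f x := by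
  rw [homExt, homExt, norm_smul, Real.norm_of_nonneg hc.le, smul_smul, smul_smul, mul_inv,
    mul_assoc, mul_comm ‖x‖⁻¹, inv_mul_cancel_left₀ hc.ne']

lemma homExt_sph (f : EuclideanSpace ℝ (Fin 5) → ℍ[ℝ]) (x : Sph 4) : homExt f x = f x := by
  rw [homExt, norm_sph, inv_one, one_smul, one_smul]

lemma contDiffAt_homExt {f : EuclideanSpace ℝ (Fin 5) → ℍ[ℝ]} (hf : ContDiff ℝ 1 f)
    {x : EuclideanSpace ℝ (Fin 5)} (hx : x ≠ 0) : ContDiffAt ℝ 1 (homExt f) x := by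
  have hn : ContDiffAt ℝ 1 (fun x : EuclideanSpace ℝ (Fin 5) => ‖x‖) x := contDiffAt_norm ℝ hx
  exact hn.smul (hf.contDiffAt.comp x ((hn.inv (norm_ne_zero_iff.2 hx)).smul contDiffAt_id))

lemma dense_generic {f : EuclideanSpace ℝ (Fin 5) → ℍ[ℝ]} (hf : ContDiff ℝ 1 f)
    (N S : EuclideanSpace ℝ (Fin 5)) :
    Dense {w : ℍ[ℝ] × ℍ[ℝ] |
      (∀ (z : EuclideanSpace ℝ (Fin 4)) (τ τ' μ : ℝ), z ≠ 0 →
        ¬ (w.1 = homExt f (suspVec z τ) ∧ w.2 = μ • homExt f (suspVec z τ'))) ∧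
      (∀ c : ℝ, w.1 ≠ c • f N ∧ w.1 ≠ c • f S ∧ w.2 ≠ c • f N ∧ w.2 ≠ c • f S)} := by
  set Ψ : EuclideanSpace ℝ (Fin 4) × ℝ × ℝ × ℝ → ℍ[ℝ] × ℍ[ℝ] := fun w =>
    (homExt f (suspVec w.1 w.2.1), w.2.2.2 • homExt f (suspVec w.1 w.2.2.1)) with hΨ
  have h1 : dimH (Ψ '' {w | w.1 ≠ 0}) < (8 : ℕ) := by
    refine (dimH_image_le_finrank fun w hw => ?_).trans_lt (by norm_num)
    have h : ∀ τ : EuclideanSpace ℝ (Fin 4) × ℝ × ℝ × ℝ → ℝ, ContDiff ℝ 1 τ →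
        ContDiffAt ℝ 1 (fun w => homExt f (suspVec w.1 (τ w))) w := fun τ hτ =>
      (contDiffAt_homExt hf (suspVec_ne_zero hw _)).comp
        (f := fun w : EuclideanSpace ℝ (Fin 4) × ℝ × ℝ × ℝ => suspVec w.1 (τ w)) w
        (contDiff_suspVec.comp (contDiff_fst.prodMk hτ)).contDiffAt
    have hμ : ContDiffAt ℝ 1 (fun w : EuclideanSpace ℝ (Fin 4) × ℝ × ℝ × ℝ => w.2.2.2) w := by
      fun_prop
    exact (h (fun w => w.2.1) (by fun_prop)).prodMk (hμ.smul (h (fun w => w.2.2.1) (by fun_prop)))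
  have hpole : ∀ v : ℍ[ℝ],
      dimH (Set.range fun w : ℝ × ℍ[ℝ] => (w.1 • v, w.2)) < (8 : ℕ) ∧
      dimH (Set.range fun w : ℝ × ℍ[ℝ] => (w.2, w.1 • v)) < (8 : ℕ) := fun v =>
    ⟨(ContDiff.dimH_range_le (by fun_prop)).trans_lt (by norm_num [Quaternion.finrank_eq_four]),
      (ContDiff.dimH_range_le (by fun_prop)).trans_lt (by norm_num [Quaternion.finrank_eq_four])⟩
  have h8 : Module.finrank ℝ (ℍ[ℝ] × ℍ[ℝ]) = 8 := by simp [Quaternion.finrank_eq_four]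
  refine (dense_compl_of_dimH_lt_finrank (s := Ψ '' {w | w.1 ≠ 0} ∪
    ((Set.range (fun w : ℝ × ℍ[ℝ] => (w.1 • f N, w.2)) ∪
      Set.range (fun w : ℝ × ℍ[ℝ] => (w.1 • f S, w.2))) ∪
    (Set.range (fun w : ℝ × ℍ[ℝ] => (w.2, w.1 • f N)) ∪
      Set.range (fun w : ℝ × ℍ[ℝ] => (w.2, w.1 • f S))))) ?_).mono ?_
  · rw [h8]
    simp only [dimH_union, max_lt_iff]
    exact ⟨h1, ⟨(hpole _).1, (hpole _).1⟩, (hpole _).2, (hpole _).2⟩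
  · rintro ⟨p, q⟩ hw
    simp only [Set.mem_compl_iff, Set.mem_union, not_or, Set.mem_range, Set.mem_image] at hw
    obtain ⟨hw0, ⟨hw1, hw2⟩, hw3, hw4⟩ := hw
    refine ⟨?_, fun c => ⟨?_, ?_, ?_, ?_⟩⟩
    · rintro z τ τ' μ hz ⟨hp, hq⟩
      exact hw0 ⟨(z, τ, τ', μ), hz, Prod.ext hp.symm hq.symm⟩
    · exact fun h => hw1 ⟨(c, q), Prod.ext h.symm rfl⟩
    · exact fun h => hw2 ⟨(c, q), Prod.ext h.symm rfl⟩
    · exact fun h => hw3 ⟨(c, p), Prod.ext rfl h.symm⟩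
    · exact fun h => hw4 ⟨(c, p), Prod.ext rfl h.symm⟩

/-- The nonzero quaternions. -/
abbrev NZ : Type := {q : ℍ[ℝ] // q ≠ 0}

lemma homotopic_of_ne_zero {X : Type*} [TopologicalSpace X] {F G : C(X, NZ)}
    (H : C(X × unitInterval, ℍ[ℝ])) (hH : ∀ w, H w ≠ 0) (h0 : ∀ x, H (x, 0) = F x)
    (h1 : ∀ x, H (x, 1) = G x) : F.Homotopic G :=
  ⟨⟨⟨fun w => ⟨H (w.2, w.1), hH _⟩, by fun_prop⟩, fun x => Subtype.ext (h0 x),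
    fun x => Subtype.ext (h1 x)⟩⟩

lemma susp_bot {n : ℕ} (x : Sph n) :
    (susp n (x, Height.bot) : EuclideanSpace ℝ (Fin (n + 2))) = suspVec 0 (-1) := by
  simp [coe_susp]

lemma susp_top {n : ℕ} (x : Sph n) :
    (susp n (x, Height.top) : EuclideanSpace ℝ (Fin (n + 2))) = suspVec 0 1 := by
  simp [coe_susp]

lemma exists_generic_pair {f : EuclideanSpace ℝ (Fin 5) → ℍ[ℝ]} (hf : ContDiff ℝ 1 f) :
    ∃ p q : ℍ[ℝ], ‖p‖ = 1 ∧ ‖q‖ = 1 ∧ 0 < p.re ∧ q.re < 0 ∧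
      (∀ (x : Sph 3) (t t' : Height) (α β : ℝ), 0 < α → 0 < β →
        f (susp 3 (x, t)) = α • p → f (susp 3 (x, t')) ≠ β • q) ∧
      ∀ (x : Sph 3) (α : ℝ), 0 < α →
        (f (susp 3 (x, Height.bot)) ≠ α • p ∧ f (susp 3 (x, Height.top)) ≠ α • p) ∧
        (f (susp 3 (x, Height.bot)) ≠ α • q ∧ f (susp 3 (x, Height.top)) ≠ α • q) := by
  obtain ⟨⟨p, q⟩, ⟨hp, hq⟩, hmer, hpole⟩ :=
    (dense_generic hf (suspVec 0 1) (suspVec 0 (-1))).inter_open_nonempty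
      {w | 0 < w.1.re ∧ w.2.re < 0}
      ((isOpen_lt continuous_const (Quaternion.continuous_re.comp continuous_fst)).inter
        (isOpen_lt (Quaternion.continuous_re.comp continuous_snd) continuous_const))
      ⟨(1, -1), by simp⟩
  simp only at hp hq hmer hpole
  have hp0 : 0 < ‖p‖ := norm_pos_iff.2 fun h => by simp [h] at hp
  have hq0 : 0 < ‖q‖ := norm_pos_iff.2 fun h => by simp [h] at hq
  have hscale : ∀ {α : ℝ} {y v : ℍ[ℝ]}, 0 < α → 0 < ‖v‖ → y = α • ‖v‖⁻¹ • v →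
      v = (α⁻¹ * ‖v‖) • y := by
    intro α y v hα hv h
    have h1 : α⁻¹ * ‖v‖ * α * ‖v‖⁻¹ = 1 := by field_simp
    rw [h, smul_smul, smul_smul, h1, one_smul]
  have hends : ∀ (x : Sph 3) (α : ℝ), 0 < α →
        (f (susp 3 (x, Height.bot)) ≠ α • ‖p‖⁻¹ • p ∧ f (susp 3 (x, Height.top)) ≠ α • ‖p‖⁻¹ • p) ∧
        (f (susp 3 (x, Height.bot)) ≠ α • ‖q‖⁻¹ • q ∧
          f (susp 3 (x, Height.top)) ≠ α • ‖q‖⁻¹ • q) := by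
    intro x α hα
    rw [susp_bot, susp_top]
    exact ⟨⟨fun h => (hpole _).2.1 (hscale hα hp0 h), fun h => (hpole _).1 (hscale hα hp0 h)⟩,
      fun h => (hpole _).2.2.2 (hscale hα hq0 h), fun h => (hpole _).2.2.1 (hscale hα hq0 h)⟩
  refine ⟨‖p‖⁻¹ • p, ‖q‖⁻¹ • q, norm_smul_inv_norm (𝕜 := ℝ) (norm_pos_iff.1 hp0),
    norm_smul_inv_norm (𝕜 := ℝ) (norm_pos_iff.1 hq0), ?_, ?_, ?_, hends⟩
  · simpa using mul_pos (inv_pos.2 hp0) hp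
  · simpa using mul_neg_of_pos_of_neg (inv_pos.2 hq0) hq
  intro x t t' α β hα hβ h h'
  have hs : ∀ t : Height, t ≠ Height.bot → t ≠ Height.top → 0 < √(1 - (t : ℝ) ^ 2) := by
    intro t hb ht
    refine Real.sqrt_pos.2 (lt_of_le_of_ne t.one_sub_sq_nonneg fun h => ?_)
    rcases Height.eq_bot_or_top_of_sq h.symm with h | h
    exacts [hb h, ht h]
  have hst := hs t (by rintro rfl; exact (hends x α hα).1.1 h)
    (by rintro rfl; exact (hends x α hα).1.2 h)
  have hst' := hs t' (by rintro rfl; exact (hends x β hβ).2.1 h')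
    (by rintro rfl; exact (hends x β hβ).2.2 h')
  set s := √(1 - (t : ℝ) ^ 2) with hs_def
  set s' := √(1 - (t' : ℝ) ^ 2) with hs_def'
  set A := α⁻¹ * ‖p‖ with hA
  set B := β⁻¹ * ‖q‖ with hB
  have hA0 : 0 < A := by positivity
  have hpf := hscale hα hp0 h
  have hqf := hscale hβ hq0 h'
  rw [← hA, ← homExt_sph f, ← homExt_smul f hA0, coe_susp, smul_suspVec, smul_smul, ← hs_def] at hpf
  rw [← hB, ← homExt_sph f] at hqf
  have hk : 0 < A * s / s' := by positivity
  refine hmer ((A * s) • x) (A * t) (A * s / s' * t') (B * (A * s / s')⁻¹)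
    (smul_ne_zero (by positivity) (norm_ne_zero_iff.1 (by rw [norm_sph]; norm_num)))
    ⟨hpf, hqf.trans ?_⟩
  have h3 : suspVec ((A * s) • (x : EuclideanSpace ℝ (Fin 4))) (A * s / s' * t') =
      (A * s / s') • (susp 3 (x, t') : EuclideanSpace ℝ (Fin 5)) := by
    rw [coe_susp, smul_suspVec, smul_smul, ← hs_def', div_mul_cancel₀ _ hst'.ne']
  rw [h3, homExt_smul f hk, smul_smul, mul_assoc, inv_mul_cancel₀ hk.ne', mul_one]

/-- After a homotopy, a map to the nonzero quaternions takes no real values at the poles, and does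
not take both positive and negative real values on the same meridian. -/
lemma exists_general_position (F : C(Sph 4, NZ)) : ∃ G : C(Sph 4, NZ), F.Homotopic G ∧
    (∀ (x : Sph 3) (t t' : Height) (α β : ℝ), 0 < α → β < 0 →
      (G (susp 3 (x, t))).1 = α → (G (susp 3 (x, t'))).1 ≠ β) ∧
    ∀ (x : Sph 3) (α : ℝ), (G (susp 3 (x, Height.bot))).1 ≠ α ∧
      (G (susp 3 (x, Height.top))).1 ≠ α := by
  obtain ⟨f, hf, hfF⟩ := exists_contDiff_near ⟨fun x => (F x).1, by fun_prop⟩ fun x => (F x).2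
  simp only [ContinuousMap.coe_mk] at hfF
  have hfc : Continuous fun x : Sph 4 => f x := hf.continuous.comp continuous_subtype_val
  have hf0 : ∀ x : Sph 4, f x ≠ 0 := fun x h => by simpa [h] using hfF x
  obtain ⟨p, q, hp, hq, hpr, hqr, hmer, hends⟩ := exists_generic_pair hf
  obtain ⟨c, hc⟩ : ∃ c : ℍ[ℝ], c = (2 : ℝ)⁻¹ • (p + q) := ⟨_, rfl⟩
  obtain ⟨a, ha⟩ : ∃ a : ℍ[ℝ], a = (2 : ℝ)⁻¹ • (p - q) := ⟨_, rfl⟩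
  have hpc : p = c + a := by rw [hc, ha]; module
  have hqc : q = c - a := by rw [hc, ha]; module
  have har : 0 < a.re := by
    rw [ha]
    simp
    linarith
  have ha0 : a ≠ 0 := fun h => by simp [h] at har
  have hp2 : Quaternion.normSq p = 1 := by rw [Quaternion.normSq_eq_norm_mul_self, hp, one_mul]
  have hq2 : Quaternion.normSq q = 1 := by rw [Quaternion.normSq_eq_norm_mul_self, hq, one_mul]
  have ha2 := Quaternion.normSq_pos ha0
  rw [hpc, Quaternion.normSq_def'] at hp2
  rw [hqc, Quaternion.normSq_def'] at hq2
  simp only [Quaternion.re_add, Quaternion.imI_add, Quaternion.imJ_add, Quaternion.imK_add,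
    Quaternion.re_sub, Quaternion.imI_sub, Quaternion.imJ_sub, Quaternion.imK_sub] at hp2 hq2
  have hac : Quaternion.normSq c + Quaternion.normSq a = 1 := by
    rw [Quaternion.normSq_def', Quaternion.normSq_def']
    linear_combination (hp2 + hq2) / 2
  have horth : c.re * a.re + c.imI * a.imI + c.imJ * a.imJ + c.imK * a.imK = 0 := by
    linear_combination (hp2 - hq2) / 4
  have hc1 : ‖c‖ < 1 := by
    have : ‖c‖ * ‖c‖ < 1 := by
      rw [← Quaternion.normSq_eq_norm_mul_self]
      linarith
    nlinarith [norm_nonneg c]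
  have hsub : ∀ (x : Sph 4) (s : unitInterval), f x - ((s : ℝ) * ‖f x‖) • c ≠ 0 := by
    intro x s h
    have h1 := congrArg norm (sub_eq_zero.1 h)
    rw [norm_smul, Real.norm_of_nonneg (mul_nonneg s.2.1 (norm_nonneg _))] at h1
    have h2 := norm_pos_iff.2 (hf0 x)
    have h3 := s.2.2
    have h4 := s.2.1
    have h5 : (s : ℝ) * ‖c‖ < 1 := by nlinarith [norm_nonneg c]
    nlinarith
  let F₁ : C(Sph 4, NZ) := ⟨fun x => ⟨f x, hf0 x⟩, by fun_prop⟩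
  let F₂ : C(Sph 4, NZ) := ⟨fun x => ⟨f x - ‖f x‖ • c, by simpa using hsub x 1⟩, by fun_prop⟩
  let G : C(Sph 4, NZ) := ⟨fun x => ⟨a⁻¹ * (f x - ‖f x‖ • c),
    mul_ne_zero (inv_ne_zero ha0) (by simpa using hsub x 1)⟩, by fun_prop⟩
  have key : ∀ x (r : ℝ), (G x).1 = r →
      (0 < r ∧ f x = r • p) ∨ (r < 0 ∧ f x = (-r) • q) := by
    intro x r h
    have h1 : f x - ‖f x‖ • c = r • a := by
      have : a⁻¹ * (f x - ‖f x‖ • c) = r := h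
      rw [inv_mul_eq_iff_eq_mul₀ ha0] at this
      rw [this, ← Quaternion.coe_mul_eq_smul, Quaternion.coe_commutes]
    have h2 : f x = ‖f x‖ • c + r • a := by rw [← h1]; abel
    have hn := norm_pos_iff.2 (hf0 x)
    have h3 : ‖f x‖ * ‖f x‖ = ‖f x‖ ^ 2 * Quaternion.normSq c + r ^ 2 * Quaternion.normSq a := by
      rw [← Quaternion.normSq_eq_norm_mul_self]
      conv_lhs => rw [h2]
      simp only [Quaternion.normSq_def', Quaternion.re_add, Quaternion.imI_add, Quaternion.imJ_add,
        Quaternion.imK_add, Quaternion.re_smul, Quaternion.imI_smul, Quaternion.imJ_smul,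
        Quaternion.imK_smul, smul_eq_mul]
      linear_combination 2 * ‖f x‖ * r * horth
    have h4 : (‖f x‖ - r) * (‖f x‖ + r) = 0 := by
      refine (mul_eq_zero.1
        (?_ : (‖f x‖ - r) * (‖f x‖ + r) * Quaternion.normSq a = 0)).resolve_right
        ha2.ne'
      linear_combination h3 + ‖f x‖ ^ 2 * hac
    rcases mul_eq_zero.1 h4 with h5 | h5
    · left
      have h6 : r = ‖f x‖ := by linarith
      refine ⟨h6 ▸ hn, ?_⟩
      rw [hpc, smul_add, h6]
      rwa [h6] at h2
    · right
      have h6 : r = -‖f x‖ := by linarith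
      refine ⟨by linarith, ?_⟩
      rw [h6] at h2 ⊢
      rw [hqc, neg_neg, smul_sub, sub_eq_add_neg, ← neg_smul]
      exact h2
  refine ⟨G, ?_, ?_, ?_⟩
  · have hF₁ : F.Homotopic F₁ := by
      refine homotopic_of_ne_zero ⟨fun w => (F w.1).1 + (w.2 : ℝ) • (f w.1 - (F w.1).1),
        by fun_prop⟩ (fun w h => ?_) (fun x => by simp) (fun x => by simp [F₁])
      have h1 := congrArg norm (eq_neg_of_add_eq_zero_left h)
      rw [norm_neg, norm_smul, Real.norm_of_nonneg w.2.2.1] at h1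
      have h2 := hfF w.1
      have h3 := w.2.2.2
      nlinarith [norm_nonneg (f w.1 - (F w.1).1)]
    have hF₂ : F₁.Homotopic F₂ :=
      homotopic_of_ne_zero ⟨fun w => f w.1 - ((w.2 : ℝ) * ‖f w.1‖) • c, by fun_prop⟩
        (fun w => hsub w.1 w.2) (fun x => by simp [F₁]) (fun x => by simp [F₂])
    have hG : F₂.Homotopic G := by
      refine homotopic_of_ne_zero ⟨fun w => ((1 - (w.2 : ℝ)) • (1 : ℍ[ℝ]) + (w.2 : ℝ) • a⁻¹) *
        (f w.1 - ‖f w.1‖ • c), by fun_prop⟩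
        (fun w => mul_ne_zero (fun h => ?_) (by simpa using hsub w.1 1)) (fun x => by simp [F₂])
        (fun x => by simp [G])
      have h1 := congrArg (fun q : ℍ[ℝ] => q.re) h
      have h2 : 0 < (a⁻¹).re := by
        rw [Quaternion.inv_def]
        simpa using mul_pos (inv_pos.2 ha2) har
      simp only [Quaternion.re_add, Quaternion.re_one, Quaternion.re_smul, smul_eq_mul,
        Quaternion.re_zero] at h1
      have h3 := w.2.2.1
      have h4 := w.2.2.2
      nlinarith [mul_nonneg h3 h2.le]
    exact (hF₁.trans hF₂).trans hG
  · intro x t t' α β hα hβ h h'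
    rcases key _ _ h with ⟨-, h1⟩ | ⟨h1, -⟩
    · rcases key _ _ h' with ⟨h2, -⟩ | ⟨-, h2⟩
      · linarith
      · exact hmer x t t' α (-β) hα (by linarith) h1 h2
    · linarith
  · intro x α
    constructor <;> intro h <;> rcases key _ _ h with ⟨h1, h2⟩ | ⟨h1, h2⟩
    · exact (hends x _ h1).1.1 h2
    · exact (hends x (-α) (by linarith)).2.1 h2
    · exact (hends x _ h1).1.2 h2
    · exact (hends x (-α) (by linarith)).2.2 h2

lemma exists_homotopic_of_cylinder {n : ℕ} {Y : Type*} [TopologicalSpace Y]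
    (G : C(Sph (n + 1), Y)) (H : C((Sph n × Height) × unitInterval, Y))
    (hH : ∀ s, EndConst fun w => H (w, s)) (h0 : ∀ w, G (susp n w) = H (w, 0)) :
    ∃ G' : C(Sph (n + 1), Y), G.Homotopic G' ∧ ∀ w, G' (susp n w) = H (w, 1) := by
  obtain ⟨a₀, a₁, h₀, h₁, ha⟩ := EndConst.exists_homotopy H hH
  have : G = a₀ := by
    ext y
    obtain ⟨w, rfl⟩ := susp_surjective n y
    rw [h0, h₀]
  exact ⟨a₁, this ▸ ha, h₁⟩

lemma exists_homotopic_ne_zero (G : C(Sph 4, NZ)) (H : C((Sph 3 × Height) × unitInterval, ℍ[ℝ]))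
    (hne : ∀ w, H w ≠ 0) (hH : ∀ s, EndConst fun w => H (w, s))
    (h0 : ∀ w, (G (susp 3 w)).1 = H (w, 0)) :
    ∃ G' : C(Sph 4, NZ), G.Homotopic G' ∧ ∀ w, (G' (susp 3 w)).1 = H (w, 1) := by
  obtain ⟨G', hG, h1⟩ := exists_homotopic_of_cylinder G ⟨fun w => (⟨H w, hne w⟩ : NZ), by fun_prop⟩
    (fun s x x' => ⟨Subtype.ext (hH s x x').1, Subtype.ext (hH s x x').2⟩)
    (fun w => Subtype.ext (h0 w))
  exact ⟨G', hG, fun w => congrArg Subtype.val (h1 w)⟩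

/-- There is a section separating the positive from the negative real values of a map in general
position. -/
lemma exists_section (G : C(Sph 4, NZ))
    (hmer : ∀ (x : Sph 3) (t t' : Height) (α β : ℝ), 0 < α → β < 0 →
      (G (susp 3 (x, t))).1 = α → (G (susp 3 (x, t'))).1 ≠ β)
    (hpole : ∀ (x : Sph 3) (α : ℝ), (G (susp 3 (x, Height.bot))).1 ≠ α ∧
      (G (susp 3 (x, Height.top))).1 ≠ α) :
    ∃ τ : C(Sph 3, ℝ), (∀ x, |τ x| < 1) ∧ ∀ x (t : Height) (α : ℝ), (G (susp 3 (x, t))).1 = α →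
      (0 < α → t < τ x) ∧ (α < 0 → τ x < t) := by
  have hGc : Continuous fun w => (G (susp 3 w)).1 := by fun_prop
  have himc : Continuous fun w => (G (susp 3 w)).1.im := by
    have h : Continuous fun q : ℍ[ℝ] => q - (q.re : ℍ[ℝ]) := by
      exact continuous_id.sub (Quaternion.continuous_coe.comp Quaternion.continuous_re)
    refine (h.comp hGc).congr fun w => ?_
    simp
  have hrec : Continuous fun w => (G (susp 3 w)).1.re := Quaternion.continuous_re.comp hGc
  have hcoe : ∀ q : ℍ[ℝ], q.im = 0 → q = (q.re : ℍ[ℝ]) := fun q h => by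
    conv_lhs => rw [← Quaternion.re_add_im q, h, add_zero]
  set C : Set (Sph 3 × Height) := {w | (G (susp 3 w)).1.im = 0 ∧ 0 ≤ (G (susp 3 w)).1.re} with hC
  set D : Set (Sph 3 × Height) := {w | (G (susp 3 w)).1.im = 0 ∧ (G (susp 3 w)).1.re ≤ 0} with hD
  have hCc : IsCompact C :=
    ((isClosed_eq himc continuous_const).inter (isClosed_le continuous_const hrec)).isCompact
  have hDc : IsCompact D :=
    ((isClosed_eq himc continuous_const).inter (isClosed_le hrec continuous_const)).isCompact
  obtain ⟨δ, hδ, hδ'⟩ := (hCc.union hDc).exists_forall_le' (f := fun w => 1 - |(w.2 : ℝ)|) (a := 0)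
    (by fun_prop) (by
      rintro ⟨x, t⟩ hw
      have him : (G (susp 3 (x, t))).1.im = 0 := by
        rcases hw with h | h <;> exact h.1
      refine lt_of_le_of_ne (sub_nonneg.2 (abs_le.2 t.2)) fun h => ?_
      have ht : 1 - (t : ℝ) ^ 2 = 0 := by
        rw [← sq_abs]
        simp only at h
        nlinarith
      rcases Height.eq_bot_or_top_of_sq ht with rfl | rfl
      · exact (hpole x _).1 (hcoe _ him)
      · exact (hpole x _).2 (hcoe _ him))
  obtain ⟨φ, hφ0, hφ1, hφ⟩ := exists_continuous_zero_one_of_isClosed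
    (hCc.image continuous_fst).isClosed (hDc.image continuous_fst).isClosed (by
      rw [Set.disjoint_left]
      rintro x ⟨⟨_, t⟩, hc, rfl⟩ ⟨⟨x, t'⟩, hd, rfl⟩
      have h1 := hcoe _ hc.1
      have h2 := hcoe _ hd.1
      refine hmer x t t' _ _ (lt_of_le_of_ne hc.2 fun h => (G _).2 (h1.trans ?_))
        (lt_of_le_of_ne hd.2 fun h => (G _).2 (h2.trans ?_)) h1 h2
      · rw [← h]; simp
      · rw [h]; simp)
  set k : ℝ := 1 - min δ 1 / 2 with hk
  have hmin : 0 < min δ 1 := lt_min hδ one_pos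
  have hk1 : k < 1 := by linarith
  have hk0 : 0 < k := by linarith [min_le_right δ 1]
  have hkδ : 1 - δ < k := by linarith [min_le_left δ 1]
  refine ⟨⟨fun x => k * (1 - 2 * φ x), by fun_prop⟩, fun x => ?_,
    fun x t α h => ⟨fun hα => ?_, fun hα => ?_⟩⟩
  · obtain ⟨h0, h1⟩ := hφ x
    simp only [ContinuousMap.coe_mk]
    rw [abs_lt]
    constructor <;> nlinarith
  · have hw : (x, t) ∈ C := ⟨by rw [h]; simp, by rw [h]; simpa using hα.le⟩
    have h1 : φ x = 0 := hφ0 ⟨_, hw, rfl⟩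
    have h2 := hδ' _ (Or.inl hw)
    simp only [ContinuousMap.coe_mk, h1] at h2 ⊢
    linarith [le_abs_self (t : ℝ)]
  · have hw : (x, t) ∈ D := ⟨by rw [h]; simp, by rw [h]; simpa using hα.le⟩
    have h1 : φ x = 1 := hφ1 ⟨_, hw, rfl⟩
    have h2 := hδ' _ (Or.inr hw)
    simp only [ContinuousMap.coe_mk, h1] at h2 ⊢
    linarith [neg_abs_le (t : ℝ)]

/-- The reparametrized height above the section. -/
noncomputable def heightOver (τ t : ℝ) : ℝ := (t - τ) / (1 - t * τ)

lemma one_sub_mul_pos {τ : ℝ} (hτ : |τ| < 1) (t : Height) : 0 < 1 - t * τ := by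
  obtain ⟨h1, h2⟩ := abs_lt.1 hτ
  obtain ⟨h3, h4⟩ := t.2
  rcases le_total 0 (t : ℝ) with h | h <;> nlinarith

lemma heightOver_pos {τ : ℝ} (hτ : |τ| < 1) {t : Height} : 0 < heightOver τ t ↔ τ < t := by
  rw [heightOver, div_pos_iff_of_pos_right (one_sub_mul_pos hτ t), sub_pos]

lemma heightOver_neg {τ : ℝ} (hτ : |τ| < 1) {t : Height} : heightOver τ t < 0 ↔ t < τ := by
  rw [heightOver, div_lt_iff₀ (one_sub_mul_pos hτ t), zero_mul, sub_neg]

lemma heightOver_bot {τ : ℝ} (hτ : |τ| < 1) : heightOver τ Height.bot = -1 := by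
  have := one_sub_mul_pos hτ Height.bot
  rw [heightOver, div_eq_iff this.ne']
  simp
  ring

lemma heightOver_top {τ : ℝ} (hτ : |τ| < 1) : heightOver τ Height.top = 1 := by
  have := one_sub_mul_pos hτ Height.top
  rw [heightOver, div_eq_iff this.ne']
  simp

/-- Maps to the nonzero quaternions in general position deform to suspensions of maps to the
imaginary unit quaternions. -/
lemma exists_suspension_form (G : C(Sph 4, NZ)) (τ : C(Sph 3, ℝ)) (hτ : ∀ x, |τ x| < 1)
    (hsec : ∀ x (t : Height) (α : ℝ), (G (susp 3 (x, t))).1 = α →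
      (0 < α → t < τ x) ∧ (α < 0 → τ x < t)) :
    ∃ (G' : C(Sph 4, NZ)) (u : C(Sph 3, ℍ[ℝ])), G.Homotopic G' ∧ (∀ x, u x * u x = -1) ∧
      ∀ w, (G' (susp 3 w)).1 = (1 - (w.2 : ℝ) ^ 2) • u w.1 - (w.2 : ℝ) • 1 := by
  have hGc : Continuous fun w => (G (susp 3 w)).1 := by fun_prop
  have hGc' : Continuous fun w : (Sph 3 × Height) × unitInterval => (G (susp 3 w.1)).1 := by
    fun_prop
  have hcoe : ∀ q : ℍ[ℝ], q.im = 0 → q = (q.re : ℍ[ℝ]) := fun q h => by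
    conv_lhs => rw [← Quaternion.re_add_im q, h, add_zero]
  have hends := endConst_comp_susp (n := 3) fun x => (G x).1
  let r : Sph 3 × Height → ℝ := fun w => heightOver (τ w.1) w.2
  have hrc : Continuous r := by
    refine Continuous.div (by fun_prop) (by fun_prop) fun w => (one_sub_mul_pos (hτ _) _).ne'
  have hrb : ∀ x, r (x, Height.bot) = -1 := fun x => heightOver_bot (hτ x)
  have hrt : ∀ x, r (x, Height.top) = 1 := fun x => heightOver_top (hτ x)
  have hτI : ∀ x, τ x ∈ Set.Icc (-1 : ℝ) 1 := fun x => abs_le.1 (hτ x).le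
  let σ : Sph 3 → Sph 3 × Height := fun x => (x, ⟨τ x, hτI x⟩)
  have hσ : Continuous σ := by fun_prop
  have him0 : ∀ x, (G (susp 3 (σ x))).1.im ≠ 0 := by
    intro x h
    have h1 := hcoe _ h
    obtain ⟨h2, h3⟩ := hsec x _ _ h1
    rcases lt_trichotomy (G (susp 3 (σ x))).1.re 0 with h | h | h
    · exact lt_irrefl _ (h3 h)
    · refine (G (susp 3 (σ x))).2 (h1.trans ?_)
      rw [h]
      simp
    · exact lt_irrefl _ (h2 h)
  have himc : Continuous fun x => (G (susp 3 (σ x))).1.im := by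
    have h : Continuous fun q : ℍ[ℝ] => q - (q.re : ℍ[ℝ]) :=
      continuous_id.sub (Quaternion.continuous_coe.comp Quaternion.continuous_re)
    refine (h.comp (hGc.comp hσ)).congr fun x => ?_
    simp
  let u : C(Sph 3, ℍ[ℝ]) := ⟨fun x => ‖(G (susp 3 (σ x))).1.im‖⁻¹ • (G (susp 3 (σ x))).1.im,
    (himc.norm.inv₀ fun x => norm_ne_zero_iff.2 (him0 x)).smul himc⟩
  have hu_re : ∀ x, (u x).re = 0 := fun x => by simp [u]
  have hu_norm : ∀ x, Quaternion.normSq (u x) = 1 := fun x =>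
    Quaternion.normSq_inv_norm_smul (him0 x)
  have hu0 : ∀ x, u x ≠ 0 := fun x h => by
    have := hu_norm x
    simp [h] at this
  have hu_sq : ∀ x, u x * u x = -1 := by
    intro x
    have h := hu_norm x
    rw [Quaternion.normSq_def', hu_re] at h
    ext <;> simp [hu_re] <;> linarith
  let ip : ℍ[ℝ] → ℍ[ℝ] → ℝ := fun a b => a.imI * b.imI + a.imJ * b.imJ + a.imK * b.imK
  have hip : ∀ w, ip (G (susp 3 w)).1 (u w.1) ≤ 0 → r w ≠ 0 := by
    rintro ⟨x, t⟩ hle h0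
    have ht : (t : ℝ) = τ x := by
      rcases lt_trichotomy (t : ℝ) (τ x) with h | h | h
      · exact absurd h0 ((heightOver_neg (hτ x)).2 h).ne
      · exact h
      · exact absurd h0 ((heightOver_pos (hτ x)).2 h).ne'
    have ht' : t = ⟨τ x, hτI x⟩ := Subtype.ext ht
    subst ht'
    have hn := norm_pos_iff.2 (him0 x)
    have h1 : ip (G (susp 3 (σ x))).1 (u x) =
        ‖(G (susp 3 (σ x))).1.im‖⁻¹ * Quaternion.normSq (G (susp 3 (σ x))).1.im := by
      simp [ip, u, Quaternion.normSq_def']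
      ring
    have h2 := mul_pos (inv_pos.2 hn) (Quaternion.normSq_pos (him0 x))
    rw [← h1] at h2
    exact absurd hle (not_le.2 h2)
  have hipc : Continuous fun w => ip (G (susp 3 w)).1 (u w.1) := by
    have := Quaternion.continuous_imI
    have := Quaternion.continuous_imJ
    have := Quaternion.continuous_imK
    fun_prop
  obtain ⟨M₀, hM₀⟩ := (isClosed_le hipc continuous_const).isCompact.exists_bound_of_continuousOn
    (f := fun w => (G (susp 3 w)).1.re / r w)
    (ContinuousOn.div (Quaternion.continuous_re.comp hGc).continuousOn hrc.continuousOn hip)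
  set M := max M₀ 0 + 1 with hM
  have hM0 : 0 < M := by positivity
  obtain ⟨G₁, hG₁, hG₁'⟩ := exists_homotopic_ne_zero G
    ⟨fun w => (G (susp 3 w.1)).1 - ((w.2 : ℝ) * M * r w.1) • 1, by fun_prop⟩
    (by
      rintro ⟨⟨x, t⟩, s⟩ h
      have h1 : (G (susp 3 (x, t))).1 = ((s * M * r (x, t) : ℝ) : ℍ[ℝ]) := by
        rw [sub_eq_zero.1 h, ← Quaternion.coe_mul_eq_smul, mul_one]
      have hs : 0 ≤ (s : ℝ) * M := mul_nonneg s.2.1 hM0.le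
      obtain ⟨h2, h3⟩ := hsec x t _ h1
      rcases lt_trichotomy ((s : ℝ) * M * r (x, t)) 0 with h | h | h
      · exact lt_asymm (h3 h) ((heightOver_neg (hτ x)).1 (neg_of_mul_neg_right h hs))
      · refine (G _).2 (h1.trans ?_)
        rw [h]
        simp
      · exact lt_asymm (h2 h) ((heightOver_pos (hτ x)).1 (pos_of_mul_pos_right h hs)))
    (fun s x x' => by simp [hrb, hrt, (hends x x').1, (hends x x').2])
    (fun w => by simp)
  obtain ⟨G₂, hG₂, hG₂'⟩ := exists_homotopic_ne_zero G₁
    ⟨fun w => (1 - (w.2 : ℝ)) • (G (susp 3 w.1)).1 + ((w.2 : ℝ) * (1 - (w.1.2 : ℝ) ^ 2)) • u w.1.1 -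
      (M * r w.1) • 1, by fun_prop⟩
    (by
      rintro ⟨⟨x, t⟩, s⟩ h
      have h0 := s.2.1
      have h1 := s.2.2
      have hre := congrArg (fun q : ℍ[ℝ] => q.re) h
      have hI := congrArg (fun q : ℍ[ℝ] => q.imI) h
      have hJ := congrArg (fun q : ℍ[ℝ] => q.imJ) h
      have hK := congrArg (fun q : ℍ[ℝ] => q.imK) h
      simp [hu_re] at hre hI hJ hK
      have hn := hu_norm x
      rw [Quaternion.normSq_def', hu_re] at hn
      have hsum : (1 - (s : ℝ)) * ip (G (susp 3 (x, t))).1 (u x) + s * (1 - (t : ℝ) ^ 2) = 0 := by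
        simp only [ip]
        linear_combination (u x).imI * hI + (u x).imJ * hJ + (u x).imK * hK -
          s * (1 - (t : ℝ) ^ 2) * hn
      rcases le_or_gt (ip (G (susp 3 (x, t))).1 (u x)) 0 with hle | hlt
      · have h2 := hM₀ (x, t) hle
        have h3 := abs_pos.2 (hip (x, t) hle)
        rw [Real.norm_eq_abs, abs_div, div_le_iff₀ h3] at h2
        have h4 : |(1 - (s : ℝ)) * (G (susp 3 (x, t))).1.re| = M * |r (x, t)| := by
          rw [sub_eq_zero.1 hre, abs_mul, abs_of_pos hM0]
        rw [abs_mul, abs_of_nonneg (by linarith)] at h4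
        have h5 : (1 - (s : ℝ)) * |(G (susp 3 (x, t))).1.re| ≤ |(G (susp 3 (x, t))).1.re| := by
          nlinarith [abs_nonneg (G (susp 3 (x, t))).1.re]
        have h6 : M₀ < M := by rw [hM]; linarith [le_max_left M₀ 0]
        nlinarith
      · have h2 := t.one_sub_sq_nonneg
        have h3 : 0 ≤ (s : ℝ) * (1 - (t : ℝ) ^ 2) := mul_nonneg h0 h2
        have h4 : (s : ℝ) = 1 := by nlinarith
        rw [h4] at hsum hre
        have h5 : 1 - (t : ℝ) ^ 2 = 0 := by linarith
        rcases Height.eq_bot_or_top_of_sq h5 with rfl | rfl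
        · rw [hrb] at hre
          linarith
        · rw [hrt] at hre
          linarith)
    (fun s x x' => by simp [hrb, hrt, (hends x x').1, (hends x x').2])
    (fun w => by rw [hG₁']; simp)
  obtain ⟨G₃, hG₃, hG₃'⟩ := exists_homotopic_ne_zero G₂
    ⟨fun w => (1 - (w.1.2 : ℝ) ^ 2) • u w.1.1 -
      ((1 - (w.2 : ℝ)) * (M * r w.1) + (w.2 : ℝ) * w.1.2) • 1, by fun_prop⟩
    (by
      rintro ⟨⟨x, t⟩, s⟩ h
      have h0 := s.2.1
      have h1 := s.2.2
      have hre := congrArg (fun q : ℍ[ℝ] => q.re) h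
      simp [hu_re] at hre
      have h2 : (1 - (t : ℝ) ^ 2) • u x = 0 := by
        have h3 := sub_eq_zero.1 h
        simp only at h3
        rw [h3]
        have h4 : (1 - (s : ℝ)) * (M * r (x, t)) + (s : ℝ) * t = 0 := by linarith
        rw [h4, zero_smul]
      have h5 : 0 < (s : ℝ) + (1 - s) * M := by
        rcases eq_or_lt_of_le h1 with h | h
        · rw [h]
          norm_num
        · linarith [mul_pos (sub_pos.2 h) hM0]
      rcases Height.eq_bot_or_top_of_sq ((smul_eq_zero.1 h2).resolve_right (hu0 x)) with rfl | rfl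
      · rw [hrb, Height.coe_bot] at hre
        linarith
      · rw [hrt, Height.coe_top] at hre
        linarith)
    (fun s x x' => by simp [hrb, hrt])
    (fun w => by rw [hG₂']; simp)
  exact ⟨G₃, u, (hG₁.trans hG₂).trans hG₃, hu_sq, fun w => by rw [hG₃']; simp⟩

/-- The coordinate form of maps to the nonzero quaternions up to homotopy. -/
lemma exists_conjugate_form (F : C(Sph 4, NZ)) :
    ∃ (G : C(Sph 4, NZ)) (q : C(Sph 3, ℍ[ℝ])), F.Homotopic G ∧ (∀ x, q x ≠ 0) ∧
      ∀ w, (G (susp 3 w)).1 = q w.1 *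
        ((1 - (w.2 : ℝ) ^ 2) • Quaternion.unitI - (w.2 : ℝ) • 1) * (q w.1)⁻¹ := by
  obtain ⟨G, hG, hmer, hpole⟩ := exists_general_position F
  obtain ⟨τ, hτ, hsec⟩ := exists_section G hmer hpole
  obtain ⟨G', u, hG', hu, hform⟩ := exists_suspension_form G τ hτ hsec
  obtain ⟨q, hq⟩ := Quaternion.exists_hopf_lift u hu
  refine ⟨G', q, hG.trans hG', fun x => (hq x).1, fun w => ?_⟩
  rw [hform, mul_sub, sub_mul, mul_smul_comm, mul_smul_comm, smul_mul_assoc, smul_mul_assoc,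
    (hq _).2, mul_one, mul_inv_cancel₀ (hq _).1, mul_inv_cancel_right₀ (hq _).1]

/-- The coordinates of the orthogonal projection of a matrix to the symmetric trace-free
matrices. -/
noncomputable def coord (M : Matrix (Fin 3) (Fin 3) ℝ) : Fin 5 → ℝ :=
  fun k => (1 / 2 : ℝ) * (M * Xmat (Pi.single k 1)).trace

lemma coord_eq (M : Matrix (Fin 3) (Fin 3) ℝ) : coord M =
    ![(M 0 0 + M 1 1 - 2 * M 2 2) / (2 * √3), (M 0 2 + M 2 0) / 2, (M 1 2 + M 2 1) / 2,
      (M 0 1 + M 1 0) / 2, (M 1 1 - M 0 0) / 2] := by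
  ext k
  fin_cases k <;> simp [coord, Xmat, Matrix.trace, Fin.sum_univ_three, Matrix.mul_apply] <;> ring

lemma Xmat_coord {M : Matrix (Fin 3) (Fin 3) ℝ} (hM : Mᵀ = M) (htr : M.trace = 0) :
    Xmat (coord M) = M := by
  have h3 : √3 * √3 = (3 : ℝ) := Real.mul_self_sqrt (by norm_num)
  have h01 : M 1 0 = M 0 1 := congrFun (congrFun hM 0) 1
  have h02 : M 2 0 = M 0 2 := congrFun (congrFun hM 0) 2
  have h12 : M 2 1 = M 1 2 := congrFun (congrFun hM 1) 2
  rw [trace_fin_three] at htr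
  have h22 : M 2 2 = -(M 0 0 + M 1 1) := by linarith
  have key : ∀ r : ℝ, r / (2 * √3) / √3 = r / 6 := fun r => by
    rw [div_div, mul_assoc, h3]
    norm_num
  have key' : ∀ r : ℝ, -(2 * (r / (2 * √3))) / √3 = -(2 * r / 6) := fun r => by
    rw [neg_div, mul_div_assoc, key, mul_div_assoc]
  rw [coord_eq]
  ext i j
  fin_cases i <;> fin_cases j <;> simp [Xmat, key, key', h01, h02, h12, h22] <;> ring

lemma coord_Xmat (x : Fin 5 → ℝ) : coord (Xmat x) = x := by
  have h3 : √3 * √3 = (3 : ℝ) := Real.mul_self_sqrt (by norm_num)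
  have h0 : √3 ≠ (0 : ℝ) := by positivity
  rw [coord_eq]
  ext k
  fin_cases k <;> simp [Xmat]
  field_simp
  linear_combination (-2 * x 0) * h3

lemma Xmat_transpose (x : Fin 5 → ℝ) : (Xmat x)ᵀ = Xmat x := by
  ext i j
  fin_cases i <;> fin_cases j <;> rfl

lemma trace_Xmat (x : Fin 5 → ℝ) : (Xmat x).trace = 0 := by
  rw [trace_fin_three]
  simp [Xmat]
  ring

lemma Xmat_eq_sum (x : Fin 5 → ℝ) : Xmat x = ∑ l, x l • Xmat (Pi.single l 1) := by
  ext i j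
  fin_cases i <;> fin_cases j <;>
    simp [Xmat, Fin.sum_univ_five, Matrix.add_apply] <;> ring

lemma rhoMat_mulVec (h : Matrix (Fin 3) (Fin 3) ℝ) (x : Fin 5 → ℝ) :
    rhoMat h *ᵥ x = coord (h * Xmat x * h⁻¹) := by
  ext k
  simp only [coord, rhoMat, mulVec, dotProduct, of_apply]
  rw [Xmat_eq_sum x]
  simp only [Matrix.sum_mul, Matrix.trace_sum, Matrix.mul_smul, Matrix.smul_mul,
    Matrix.trace_smul, smul_eq_mul, Finset.mul_sum]
  exact Finset.sum_congr rfl fun l _ => by ring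

lemma inv_eq_transpose {h : Matrix (Fin 3) (Fin 3) ℝ} (hh : hᵀ * h = 1) : h⁻¹ = hᵀ :=
  Matrix.inv_eq_left_inv hh

lemma rhoMat_mulVec_coord {h M : Matrix (Fin 3) (Fin 3) ℝ} (hh : hᵀ * h = 1) (hM : Mᵀ = M)
    (htr : M.trace = 0) : rhoMat h *ᵥ coord M = coord (h * M * hᵀ) := by
  rw [rhoMat_mulVec, Xmat_coord hM htr, inv_eq_transpose hh]

lemma rhoMat_mul {h k : Matrix (Fin 3) (Fin 3) ℝ} (hh : hᵀ * h = 1) (hk : kᵀ * k = 1) :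
    rhoMat (h * k) = rhoMat h * rhoMat k := by
  refine Matrix.ext_of_mulVec_single fun l => ?_
  have hhk : (h * k)ᵀ * (h * k) = 1 := by
    rw [transpose_mul, mul_assoc, ← mul_assoc hᵀ, hh, one_mul, hk]
  rw [← mulVec_mulVec, rhoMat_mulVec, rhoMat_mulVec k, rhoMat_mulVec_coord hh,
    inv_eq_transpose hk, inv_eq_transpose hhk, transpose_mul]
  · simp only [mul_assoc]
  · rw [inv_eq_transpose hk]
    simp only [transpose_mul, transpose_transpose, Xmat_transpose, mul_assoc]
  · rw [inv_eq_transpose hk, trace_mul_comm, ← mul_assoc, hk, one_mul, trace_Xmat]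

lemma rhoMat_one : rhoMat 1 = 1 := by
  refine Matrix.ext_of_mulVec_single fun l => ?_
  rw [rhoMat_mulVec, inv_one, mul_one, one_mul, coord_Xmat, one_mulVec]

lemma rhoMat_transpose {h : Matrix (Fin 3) (Fin 3) ℝ} (hh : hᵀ * h = 1) :
    (rhoMat h)ᵀ = rhoMat hᵀ := by
  have hh' : hᵀᵀ * hᵀ = 1 := by rw [transpose_transpose, mul_eq_one_comm.1 hh]
  ext k l
  simp only [rhoMat, transpose_apply, of_apply]
  rw [inv_eq_transpose hh, inv_eq_transpose hh', transpose_transpose, mul_assoc, mul_assoc,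
    trace_mul_comm, mul_assoc, mul_assoc, trace_mul_comm, ← mul_assoc]

lemma rhoMat_transpose_mul {h : Matrix (Fin 3) (Fin 3) ℝ} (hh : hᵀ * h = 1) :
    (rhoMat h)ᵀ * rhoMat h = 1 := by
  rw [rhoMat_transpose hh, ← rhoMat_mul (by rw [transpose_transpose, mul_eq_one_comm.1 hh]) hh, hh,
    rhoMat_one]

lemma continuous_rhoMat {X : Type*} [TopologicalSpace X] {h : X → Matrix (Fin 3) (Fin 3) ℝ}
    (hc : Continuous h) (hh : ∀ x, (h x)ᵀ * h x = 1) : Continuous fun x => rhoMat (h x) := by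
  refine continuous_matrix fun k l => ?_
  simp only [rhoMat, of_apply, inv_eq_transpose (hh _)]
  fun_prop

namespace Quaternion

/-- The irreducible representation as a function of nonzero quaternions. -/
noncomputable def irr (q : ℍ[ℝ]) : Matrix (Fin 5) (Fin 5) ℝ := rhoMat (rot q)

lemma irr_transpose_mul {q : ℍ[ℝ]} (hq : q ≠ 0) : (irr q)ᵀ * irr q = 1 :=
  rhoMat_transpose_mul (rot_transpose_mul_rot hq)

lemma irr_mul {p q : ℍ[ℝ]} (hp : p ≠ 0) (hq : q ≠ 0) : irr (p * q) = irr p * irr q := by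
  rw [irr, rot_mul, rhoMat_mul (rot_transpose_mul_rot hp) (rot_transpose_mul_rot hq), irr, irr]

lemma irr_one : irr 1 = 1 := by
  rw [irr, rot_one, rhoMat_one]

lemma irr_smul {c : ℝ} (hc : c ≠ 0) (q : ℍ[ℝ]) : irr (c • q) = irr q := by
  rw [irr, rot_smul hc, irr]

lemma irr_inv {q : ℍ[ℝ]} (hq : q ≠ 0) : irr q⁻¹ = (irr q)ᵀ := by
  have h : irr q⁻¹ * irr q = 1 := by
    rw [← irr_mul (inv_ne_zero hq) hq, inv_mul_cancel₀ hq, irr_one]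
  calc irr q⁻¹ = irr q⁻¹ * (irr q * (irr q)ᵀ) := by
        rw [mul_eq_one_comm.1 (irr_transpose_mul hq), mul_one]
    _ = (irr q)ᵀ := by rw [← mul_assoc, h, one_mul]

lemma det_irr {q : ℍ[ℝ]} (hq : q ≠ 0) : (irr q).det = 1 := by
  have hsq : ∀ p : ℍ[ℝ], p ≠ 0 → (irr p).det * (irr p).det = 1 := fun p hp => by
    have := congrArg Matrix.det (irr_transpose_mul hp)
    rwa [det_mul, det_transpose, det_one] at this
  have hn : normSq q = ‖q‖ * ‖q‖ := normSq_eq_norm_mul_self q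
  by_cases hz : q + ‖q‖ • 1 = 0
  · rw [eq_neg_of_add_eq_zero_left hz, ← neg_smul,
      irr_smul (neg_ne_zero.2 (norm_ne_zero_iff.2 hq)), irr_one, det_one]
  · have h : (q + ‖q‖ • 1) * (q + ‖q‖ • 1) = (2 * (q.re + ‖q‖)) • q := by
      rw [normSq_def'] at hn
      ext <;> simp
      · linear_combination -hn
      · ring
      · ring
      · ring
    have hc : 2 * (q.re + ‖q‖) ≠ 0 := fun hc => hz (by
      rw [hc, zero_smul] at h
      exact mul_self_eq_zero.1 h)
    rw [← irr_smul hc, ← h, irr_mul hz hz, det_mul, hsq _ hz]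

lemma continuous_irr {X : Type*} [TopologicalSpace X] {q : X → ℍ[ℝ]} (hc : Continuous q)
    (hq : ∀ x, q x ≠ 0) : Continuous fun x => irr (q x) :=
  continuous_rhoMat (continuousOn_rot.comp_continuous hc hq) fun x => rot_transpose_mul_rot (hq x)

end Quaternion

/-- The reflection in the hyperplane orthogonal to a vector. -/
noncomputable def reflMat (b : Fin 5 → ℝ) : Matrix (Fin 5) (Fin 5) ℝ :=
  1 - (2 / (b ⬝ᵥ b)) • vecMulVec b b

lemma reflMat_transpose (b : Fin 5 → ℝ) : (reflMat b)ᵀ = reflMat b := by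
  simp [reflMat, transpose_vecMulVec]

lemma reflMat_mul_self {b : Fin 5 → ℝ} (hb : b ≠ 0) : reflMat b * reflMat b = 1 := by
  have h : b ⬝ᵥ b ≠ 0 := fun h => hb (dotProduct_self_eq_zero.1 h)
  have h2 : vecMulVec b b * vecMulVec b b = (b ⬝ᵥ b) • vecMulVec b b := by
    rw [vecMulVec_mul_vecMulVec, vecMulVec_smul]
  rw [reflMat, mul_sub, sub_mul, sub_mul, smul_mul_smul_comm, h2, smul_smul, mul_one, mul_one,
    one_mul, mul_assoc, div_mul_cancel₀ _ h]
  module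

lemma det_reflMat {b : Fin 5 → ℝ} (hb : b ≠ 0) : (reflMat b).det = -1 := by
  have h : b ⬝ᵥ b ≠ 0 := fun h => hb (dotProduct_self_eq_zero.1 h)
  rw [reflMat, sub_eq_add_neg, ← vecMulVec_smul, ← vecMulVec_neg,
    vecMulVec_eq Unit, det_one_add_replicateCol_mul_replicateRow, neg_dotProduct, smul_dotProduct,
    smul_eq_mul, div_mul_cancel₀ _ h]
  norm_num

lemma reflMat_smul {c : ℝ} (hc : c ≠ 0) (b : Fin 5 → ℝ) : reflMat (c • b) = reflMat b := by
  rw [reflMat, reflMat, smul_vecMulVec, vecMulVec_smul, smul_dotProduct, dotProduct_smul, smul_smul,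
    smul_smul]
  congr 2
  simp only [smul_eq_mul]
  field_simp

lemma mul_reflMat_mul_transpose {R : Matrix (Fin 5) (Fin 5) ℝ} (hR : Rᵀ * R = 1) (b : Fin 5 → ℝ) :
    R * reflMat b * Rᵀ = reflMat (R *ᵥ b) := by
  rw [reflMat, reflMat, mul_sub, sub_mul, mul_one, mul_eq_one_comm.1 hR, Matrix.mul_smul,
    Matrix.smul_mul, mul_vecMulVec, vecMulVec_mul, vecMul_transpose, dotProduct_mulVec, ← mulVec_transpose,
    mulVec_mulVec, hR, one_mulVec]

lemma continuous_reflMat {X : Type*} [TopologicalSpace X] {b : X → Fin 5 → ℝ} (hb : Continuous b)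
    (h0 : ∀ x, b x ≠ 0) : Continuous fun x => reflMat (b x) := by
  have h : ∀ x, b x ⬝ᵥ b x ≠ 0 := fun x h => h0 x (dotProduct_self_eq_zero.1 h)
  have hd : Continuous fun x => 2 / (b x ⬝ᵥ b x) :=
    continuous_const.div (hb.dotProduct hb) h
  exact continuous_const.sub (hd.smul (hb.matrix_vecMulVec hb))

/-- Membership in the special orthogonal group. -/
def IsSO (M : Matrix (Fin 5) (Fin 5) ℝ) : Prop := Mᵀ * M = 1 ∧ M.det = 1

lemma IsSO.mul {M N : Matrix (Fin 5) (Fin 5) ℝ} (hM : IsSO M) (hN : IsSO N) : IsSO (M * N) := by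
  refine ⟨?_, by rw [det_mul, hM.2, hN.2, one_mul]⟩
  rw [transpose_mul, mul_assoc, ← mul_assoc Mᵀ, hM.1, one_mul, hN.1]

lemma IsSO.transpose {M : Matrix (Fin 5) (Fin 5) ℝ} (hM : IsSO M) : IsSO Mᵀ :=
  ⟨by rw [transpose_transpose, mul_eq_one_comm.1 hM.1], by rw [det_transpose, hM.2]⟩

lemma isSO_reflMat_mul_reflMat {b c : Fin 5 → ℝ} (hb : b ≠ 0) (hc : c ≠ 0) :
    IsSO (reflMat b * reflMat c) := by
  refine ⟨?_, by rw [det_mul, det_reflMat hb, det_reflMat hc]; norm_num⟩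
  rw [transpose_mul, reflMat_transpose, reflMat_transpose, mul_assoc, ← mul_assoc (reflMat b),
    reflMat_mul_self hb, one_mul, reflMat_mul_self hc]

lemma isSO_irr {q : ℍ[ℝ]} (hq : q ≠ 0) : IsSO (Quaternion.irr q) :=
  ⟨Quaternion.irr_transpose_mul hq, Quaternion.det_irr hq⟩

lemma rhoMat_axis {c s : ℝ} (h : c ^ 2 + s ^ 2 = 1) :
    rhoMat !![c, -s, 0; s, c, 0; 0, 0, 1] =
      !![1, 0, 0, 0, 0; 0, c, -s, 0, 0; 0, s, c, 0, 0; 0, 0, 0, 1, 0; 0, 0, 0, 0, 1] *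
      (!![1, 0, 0, 0, 0; 0, 1, 0, 0, 0; 0, 0, 1, 0, 0; 0, 0, 0, c, -s; 0, 0, 0, s, c] *
      !![1, 0, 0, 0, 0; 0, 1, 0, 0, 0; 0, 0, 1, 0, 0; 0, 0, 0, c, -s; 0, 0, 0, s, c]) := by
  have hh : !![c, -s, 0; s, c, 0; 0, 0, 1]ᵀ * !![c, -s, 0; s, c, 0; 0, 0, 1] = 1 := by
    ext i j
    fin_cases i <;> fin_cases j <;>
      simp [Matrix.mul_apply, Fin.sum_univ_three] <;> grind
  refine Matrix.ext_of_mulVec_single fun l => ?_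
  rw [rhoMat_mulVec, inv_eq_transpose hh, coord_eq]
  have h3 : √3 * √3 = (3 : ℝ) := Real.mul_self_sqrt (by norm_num)
  have h0 : √3 ≠ (0 : ℝ) := by positivity
  ext k
  fin_cases l <;> fin_cases k <;>
    simp [Xmat, Matrix.mul_apply, Fin.sum_univ_three] <;>
    (try field_simp) <;> grind

lemma reflMat_mul_reflMat_left {a b : ℝ} (h : a ^ 2 + b ^ 2 ≠ 0) :
    reflMat ![0, a, b, 0, 0] * reflMat ![0, 1, 0, 0, 0] =
      !![1, 0, 0, 0, 0; 0, (a ^ 2 - b ^ 2) / (a ^ 2 + b ^ 2), -(2 * a * b / (a ^ 2 + b ^ 2)), 0, 0;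
        0, 2 * a * b / (a ^ 2 + b ^ 2), (a ^ 2 - b ^ 2) / (a ^ 2 + b ^ 2), 0, 0;
        0, 0, 0, 1, 0; 0, 0, 0, 0, 1] := by
  have h' : a * a + b * b ≠ 0 := by rwa [← sq, ← sq]
  ext i j
  fin_cases i <;> fin_cases j <;>
    simp [reflMat, Matrix.mul_apply, Fin.sum_univ_five, Matrix.one_apply] <;> field_simp <;> ring

lemma reflMat_mul_reflMat_right {a b : ℝ} (h : a ^ 2 + b ^ 2 ≠ 0) :
    reflMat ![0, 0, 0, -b, a] * reflMat ![0, 0, 0, 0, 1] =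
      !![1, 0, 0, 0, 0; 0, 1, 0, 0, 0; 0, 0, 1, 0, 0;
        0, 0, 0, (a ^ 2 - b ^ 2) / (a ^ 2 + b ^ 2), -(2 * a * b / (a ^ 2 + b ^ 2));
        0, 0, 0, 2 * a * b / (a ^ 2 + b ^ 2), (a ^ 2 - b ^ 2) / (a ^ 2 + b ^ 2)] := by
  have h' : b ^ 2 + a ^ 2 ≠ 0 := by rwa [add_comm]
  have h'' : b * b + a * a ≠ 0 := by rwa [← sq, ← sq]
  ext i j
  fin_cases i <;> fin_cases j <;>
    simp [reflMat, Matrix.mul_apply, Fin.sum_univ_five, Matrix.one_apply] <;> field_simp <;> ring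

lemma irr_axis {a b : ℝ} (h : a ^ 2 + b ^ 2 ≠ 0) :
    Quaternion.irr (a • 1 + b • Quaternion.unitK) =
      reflMat ![0, a, b, 0, 0] * reflMat ![0, 1, 0, 0, 0] *
        ((reflMat ![0, 0, 0, -b, a] * reflMat ![0, 0, 0, 0, 1]) *
        (reflMat ![0, 0, 0, -b, a] * reflMat ![0, 0, 0, 0, 1])) := by
  rw [reflMat_mul_reflMat_left h, reflMat_mul_reflMat_right h, ← rhoMat_axis, Quaternion.irr,
    Quaternion.rot, Quaternion.normSq_def']
  · congr 1
    ext i j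
    fin_cases i <;> fin_cases j <;> simp [h] <;> field_simp
  · field_simp
    ring

lemma neg_height_sq_add_ne_zero (t : ℝ) : (-t) ^ 2 + (1 - t ^ 2) ^ 2 ≠ 0 := by
  nlinarith [sq_nonneg (t ^ 2 - 1 / 2)]

lemma exists_homotopic_of_isSO (G : C(Sph 4, SO 5))
    {M : (Sph 3 × Height) × unitInterval → Matrix (Fin 5) (Fin 5) ℝ} (hc : Continuous M)
    (hM : ∀ w, IsSO (M w)) (hends : ∀ s, EndConst fun w => M (w, s))
    (h0 : ∀ w, (G (susp 3 w)).1 = M (w, 0)) :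
    ∃ G' : C(Sph 4, SO 5), G.Homotopic G' ∧ ∀ w, (G' (susp 3 w)).1 = M (w, 1) := by
  obtain ⟨G', hG, h1⟩ := exists_homotopic_of_cylinder G ⟨fun w => (⟨M w, hM w⟩ : SO 5), by fun_prop⟩
    (fun s x x' => ⟨Subtype.ext (hends s x x').1, Subtype.ext (hends s x x').2⟩)
    (fun w => Subtype.ext (h0 w))
  exact ⟨G', hG, fun w => congrArg Subtype.val (h1 w)⟩

/-- Maps given by products of two reflections deform along with the reflection vectors. -/
lemma exists_homotopic_of_reflMat_pair (G : C(Sph 4, SO 5))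
    {V : Sph 3 × unitInterval → ℝ → ℝ → Fin 5 → ℝ}
    (hc : Continuous fun p : (Sph 3 × unitInterval) × ℝ × ℝ => V p.1 p.2.1 p.2.2)
    (hV : ∀ y a b, a ^ 2 + b ^ 2 ≠ 0 → V y a b ≠ 0)
    (hodd : ∀ y a, V y (-a) 0 = -V y a 0)
    (h0 : ∀ w, (G (susp 3 w)).1 =
      reflMat (V (w.1, 0) (-w.2) (1 - (w.2 : ℝ) ^ 2)) * reflMat (V (w.1, 0) 1 0)) :
    ∃ G' : C(Sph 4, SO 5), G.Homotopic G' ∧ ∀ w, (G' (susp 3 w)).1 =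
      reflMat (V (w.1, 1) (-w.2) (1 - (w.2 : ℝ) ^ 2)) * reflMat (V (w.1, 1) 1 0) := by
  have hV1 : ∀ y, V y 1 0 ≠ 0 := fun y => hV y 1 0 (by norm_num)
  refine exists_homotopic_of_isSO G
    (M := fun w => reflMat (V (w.1.1, w.2) (-w.1.2) (1 - (w.1.2 : ℝ) ^ 2)) *
      reflMat (V (w.1.1, w.2) 1 0)) (Continuous.mul ?_ ?_) ?_ ?_ h0
  · exact continuous_reflMat (hc.comp (f := fun w : (Sph 3 × Height) × unitInterval =>
      ((w.1.1, w.2), (-(w.1.2 : ℝ), 1 - (w.1.2 : ℝ) ^ 2))) (by fun_prop))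
      fun w => hV _ _ _ (neg_height_sq_add_ne_zero _)
  · exact continuous_reflMat (hc.comp (f := fun w : (Sph 3 × Height) × unitInterval =>
      ((w.1.1, w.2), ((1 : ℝ), (0 : ℝ)))) (by fun_prop)) fun w => hV1 _
  · exact fun w => isSO_reflMat_mul_reflMat (hV _ _ _ (neg_height_sq_add_ne_zero _)) (hV1 _)
  · have hneg : ∀ v, reflMat (-v) = reflMat v := fun v => by
      rw [← neg_one_smul ℝ, reflMat_smul (by norm_num)]
    exact fun s x x' => by simp [hodd, hneg, reflMat_mul_self (hV1 _)]

/-- The symmetric product of two vectors, as a symmetric trace-free matrix. -/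
noncomputable def symProd (v w : Fin 3 → ℝ) : Fin 5 → ℝ := coord (vecMulVec v w + vecMulVec w v)

lemma rhoMat_mulVec_symProd {h : Matrix (Fin 3) (Fin 3) ℝ} (hh : hᵀ * h = 1) {v w : Fin 3 → ℝ}
    (hvw : v ⬝ᵥ w = 0) : rhoMat h *ᵥ symProd v w = symProd (h *ᵥ v) (h *ᵥ w) := by
  rw [symProd, rhoMat_mulVec_coord hh, mul_add, add_mul, mul_vecMulVec, vecMulVec_mul,
    mul_vecMulVec, vecMulVec_mul, vecMul_transpose, vecMul_transpose, symProd]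
  · rw [transpose_add, transpose_vecMulVec, transpose_vecMulVec, add_comm]
  · rw [trace_add, trace_vecMulVec, trace_vecMulVec, dotProduct_comm w, hvw, add_zero]

lemma symProd_apply (v w : Fin 3 → ℝ) : symProd v w =
    ![(v 0 * w 0 + v 1 * w 1 - 2 * (v 2 * w 2)) / √3, v 0 * w 2 + v 2 * w 0,
      v 1 * w 2 + v 2 * w 1, v 0 * w 1 + v 1 * w 0, v 1 * w 1 - v 0 * w 0] := by
  rw [symProd, coord_eq]
  ext k
  fin_cases k <;> simp [vecMulVec_apply] <;> (try field_simp) <;> ring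

/-- A linear family of symmetric trace-free matrices which are not symmetric products of
orthogonal vectors. -/
noncomputable def triVec (w : Fin 3 → ℝ) : Fin 5 → ℝ :=
  ![√3 / 2 * w 1, 0, 0, w 2, (w 1 - 2 * w 0) / 2]

lemma eq_zero_of_triVec_eq_symProd {v w : Fin 3 → ℝ} (hvw : v ⬝ᵥ w = 0)
    (h : triVec w = symProd v w) : w = 0 := by
  rw [symProd_apply, triVec] at h
  have h0 := congrFun h 0
  have h1 := congrFun h 1
  have h2 := congrFun h 2
  have h3 := congrFun h 3
  have h4 := congrFun h 4
  simp at h0 h1 h2 h3 h4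
  have hs : √3 * √3 = (3 : ℝ) := Real.mul_self_sqrt (by norm_num)
  rw [eq_div_iff (by positivity)] at h0
  have h0' : 3 / 2 * w 1 = v 0 * w 0 + v 1 * w 1 - 2 * (v 2 * w 2) := by
    linear_combination h0 - w 1 / 2 * hs
  simp only [dotProduct, Fin.sum_univ_three] at hvw
  by_cases hw : w 2 = 0
  · have hw1 : w 1 = 0 := by
      rw [hw] at h0' hvw
      linarith
    rw [hw1] at h4 hvw
    rw [hw] at hvw
    have hw0 : w 0 = 0 := by linarith
    ext i
    fin_cases i <;> assumption
  · exfalso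
    have e1 : w 1 = -2 * (v 2 * w 2) := by linarith
    have e2 : 2 * (v 0 * w 0) = w 0 := by linarith
    have e3 : 2 * (v 1 * w 1) = w 1 - w 0 := by linarith
    have e4 : w 0 * (w 2 ^ 2 - w 0 * w 1) = 0 := by grind
    have e5 : (w 1 - w 0) * w 2 ^ 2 = w 1 ^ 3 := by grind
    have e6 : w 0 * w 1 ^ 2 = w 2 ^ 3 := by grind
    have hw0 : w 0 ≠ 0 := fun h => hw (by simpa [h] using e6.symm)
    have hw1 : w 1 ≠ 0 := fun h => hw (by simpa [h] using e6.symm)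
    have e7 : w 2 ^ 2 = w 0 * w 1 := by
      linarith [(mul_eq_zero.1 e4).resolve_left hw0]
    have e8 : w 0 ^ 2 - w 0 * w 1 + w 1 ^ 2 = 0 := by
      rw [e7] at e5
      have : w 1 * (w 0 ^ 2 - w 0 * w 1 + w 1 ^ 2) = 0 := by linarith
      exact (mul_eq_zero.1 this).resolve_left hw1
    nlinarith [sq_nonneg (w 0 - w 1), sq_pos_of_ne_zero hw0, sq_pos_of_ne_zero hw1]

lemma triVec_ne_zero {w : Fin 3 → ℝ} (hw : w ≠ 0) : triVec w ≠ 0 := fun h =>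
  hw (eq_zero_of_triVec_eq_symProd (v := 0) (zero_dotProduct w) (by
    rw [h, symProd_apply]
    ext k
    fin_cases k <;> simp))

lemma symProd_single (a b : ℝ) : symProd ![0, 0, 1] ![a, b, 0] = ![0, a, b, 0, 0] := by
  rw [symProd_apply]
  ext k
  fin_cases k <;> simp

lemma mulVec_ne_zero {n : ℕ} {h : Matrix (Fin n) (Fin n) ℝ} (hh : hᵀ * h = 1) {v : Fin n → ℝ}
    (hv : v ≠ 0) : h *ᵥ v ≠ 0 := fun h0 => hv (by
  rw [← one_mulVec v, ← hh, ← mulVec_mulVec, h0, mulVec_zero])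

lemma vec_ne_zero {a b : ℝ} (hab : a ^ 2 + b ^ 2 ≠ 0) : ![a, b, 0] ≠ 0 := fun h => hab (by
  have h0 : a = 0 := congrFun h 0
  have h1 : b = 0 := congrFun h 1
  simp [h0, h1])

lemma symProd_add_triVec_ne_zero {h : Matrix (Fin 3) (Fin 3) ℝ} (hh : hᵀ * h = 1) {a b : ℝ}
    (hab : a ^ 2 + b ^ 2 ≠ 0) (s : ℝ) :
    (1 - s) • symProd (h *ᵥ ![0, 0, 1]) (h *ᵥ ![a, b, 0]) + s • triVec (h *ᵥ ![a, b, 0]) ≠ 0 := by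
  have horth : (h *ᵥ ![0, 0, 1]) ⬝ᵥ (h *ᵥ ![a, b, 0]) = 0 := by
    rw [dotProduct_mulVec, ← mulVec_transpose, mulVec_mulVec, hh, one_mulVec]
    simp
  intro h0
  rcases eq_or_ne s 0 with rfl | hs
  · rw [sub_zero, one_smul, zero_smul, add_zero, ← rhoMat_mulVec_symProd hh (by simp),
      symProd_single] at h0
    refine mulVec_ne_zero (rhoMat_transpose_mul hh) (fun h1 => hab ?_) h0
    have h2 : a = 0 := congrFun h1 1
    have h3 : b = 0 := congrFun h1 2
    simp [h2, h3]
  · refine mulVec_ne_zero hh (vec_ne_zero hab) (eq_zero_of_triVec_eq_symProd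
      (v := (-((1 - s) / s)) • (h *ᵥ ![0, 0, 1])) ?_ ?_)
    · rw [smul_dotProduct, horth, smul_zero]
    · have : symProd ((-((1 - s) / s)) • (h *ᵥ ![0, 0, 1])) (h *ᵥ ![a, b, 0]) =
          (-((1 - s) / s)) • symProd (h *ᵥ ![0, 0, 1]) (h *ᵥ ![a, b, 0]) := by
        rw [symProd_apply, symProd_apply]
        ext k
        fin_cases k <;> simp <;> ring
      rw [this, ← smul_right_inj hs, smul_smul, eq_neg_of_add_eq_zero_right h0, ← neg_smul]
      congr 1
      field_simp

/-- The deformation of the irreducible representation on the rotations about the third axis which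
removes its component of weight two. -/
noncomputable def twist (s a b : ℝ) : Matrix (Fin 5) (Fin 5) ℝ :=
  reflMat ![0, a, b, 0, 0] * reflMat ![0, 1, 0, 0, 0] *
    ((reflMat ![0, 0, 0, -b, a] * reflMat ![0, 0, 0, 0, 1]) *
    (reflMat ![b * (s * (1 - s)), 0, 0, -((1 - 2 * s) * b), a] * reflMat ![0, 0, 0, 0, 1]))

lemma twist_zero {a b : ℝ} (h : a ^ 2 + b ^ 2 ≠ 0) :
    twist 0 a b = Quaternion.irr (a • 1 + b • Quaternion.unitK) := by
  rw [irr_axis h, twist]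
  simp

lemma twist_vec_ne_zero {a b : ℝ} (h : a ^ 2 + b ^ 2 ≠ 0) (s : ℝ) :
    ![b * (s * (1 - s)), 0, 0, -((1 - 2 * s) * b), a] ≠ 0 := fun h0 => h (by
  have h1 : b * (s * (1 - s)) = 0 := congrFun h0 0
  have h2 : -((1 - 2 * s) * b) = 0 := congrFun h0 3
  have h3 : a = 0 := congrFun h0 4
  have h4 : b = 0 := by linear_combination 4 * h1 - (1 - 2 * s) * h2
  simp [h3, h4])

lemma plane_vec_ne_zero {a b : ℝ} (h : a ^ 2 + b ^ 2 ≠ 0) :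
    ![0, a, b, 0, 0] ≠ 0 := fun h0 => h (by
  have h1 : a = 0 := congrFun h0 1
  have h2 : b = 0 := congrFun h0 2
  simp [h1, h2])

lemma axis_vec_ne_zero : (![0, 0, 0, 0, 1] : Fin 5 → ℝ) ≠ 0 := fun h =>
  one_ne_zero (congrFun h 4)

lemma twist_one {a b : ℝ} (h : a ^ 2 + b ^ 2 ≠ 0) :
    twist 1 a b = reflMat ![0, a, b, 0, 0] * reflMat ![0, 1, 0, 0, 0] := by
  have h' : a ^ 2 + (-b) ^ 2 ≠ 0 := by rwa [neg_sq]
  have h1 := reflMat_mul_reflMat_right h'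
  have key : (reflMat ![0, 0, 0, -b, a] * reflMat ![0, 0, 0, 0, 1]) *
      (reflMat ![0, 0, 0, - -b, a] * reflMat ![0, 0, 0, 0, 1]) = 1 := by
    have ht : (reflMat ![0, 0, 0, -b, a] * reflMat ![0, 0, 0, 0, 1])ᵀ =
        reflMat ![0, 0, 0, - -b, a] * reflMat ![0, 0, 0, 0, 1] := by
      rw [h1, reflMat_mul_reflMat_right h]
      ext i j
      fin_cases i <;> fin_cases j <;> simp [neg_div]
    rw [← ht, mul_eq_one_comm]
    exact (isSO_reflMat_mul_reflMat (by simpa using twist_vec_ne_zero h 0) axis_vec_ne_zero).1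
  have hv : ![b * (1 * (1 - 1)), 0, 0, -((1 - 2 * 1) * b), a] = ![0, 0, 0, - -b, a] := by
    ext k
    fin_cases k <;> simp
    ring
  rw [twist, hv, key, mul_one]

lemma isSO_twist {a b : ℝ} (h : a ^ 2 + b ^ 2 ≠ 0) (s : ℝ) : IsSO (twist s a b) :=
  (isSO_reflMat_mul_reflMat (plane_vec_ne_zero h) (plane_vec_ne_zero (by norm_num))).mul
    ((isSO_reflMat_mul_reflMat (by simpa using twist_vec_ne_zero h 0) axis_vec_ne_zero).mul
      (isSO_reflMat_mul_reflMat (twist_vec_ne_zero h s) axis_vec_ne_zero))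

lemma twist_end {a : ℝ} (h : a ^ 2 = 1) (s : ℝ) : twist s a 0 = 1 := by
  have ha : a ≠ 0 := fun h0 => by simp [h0] at h
  have h1 : ![0, a, 0, 0, 0] = a • ![0, 1, 0, 0, 0] := by simp
  have h2 : ![0, 0, 0, 0, a] = a • ![0, 0, 0, 0, 1] := by simp
  simp only [twist, mul_zero, zero_mul, neg_zero]
  rw [h1, h2, reflMat_smul ha, reflMat_smul ha, reflMat_mul_self axis_vec_ne_zero,
    reflMat_mul_self (plane_vec_ne_zero (by norm_num)), mul_one, mul_one]

lemma continuous_twist {X : Type*} [TopologicalSpace X] {s a b : X → ℝ} (hs : Continuous s)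
    (ha : Continuous a) (hb : Continuous b) (h : ∀ x, a x ^ 2 + b x ^ 2 ≠ 0) :
    Continuous fun x => twist (s x) (a x) (b x) := by
  refine ((continuous_reflMat ?_ fun x => plane_vec_ne_zero (h x)).mul continuous_const).mul
    (((continuous_reflMat ?_ fun x => by simpa using twist_vec_ne_zero (h x) 0).mul
      continuous_const).mul
    ((continuous_reflMat ?_ fun x => twist_vec_ne_zero (h x) _).mul continuous_const))
  all_goals
    refine continuous_pi fun k => ?_
    fin_cases k <;> simp <;> fun_prop

lemma mul_reflMat_mul_reflMat_mul_transpose {R : Matrix (Fin 5) (Fin 5) ℝ} (hR : Rᵀ * R = 1)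
    (b c : Fin 5 → ℝ) : R * (reflMat b * reflMat c) * Rᵀ = reflMat (R *ᵥ b) * reflMat (R *ᵥ c) := by
  rw [← mul_reflMat_mul_transpose hR, ← mul_reflMat_mul_transpose hR]
  simp only [mul_assoc]
  rw [← mul_assoc Rᵀ, hR, one_mul]

/-- The weight two component can be removed from conjugates of the irreducible representation. -/
lemma exists_homotopic_symProd (G : C(Sph 4, SO 5)) (q : C(Sph 3, ℍ[ℝ])) (hq : ∀ x, q x ≠ 0)
    (h0 : ∀ w, (G (susp 3 w)).1 = Quaternion.irr (q w.1 *
      ((-w.2 : ℝ) • 1 + (1 - (w.2 : ℝ) ^ 2) • Quaternion.unitK) * (q w.1)⁻¹)) :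
    ∃ G' : C(Sph 4, SO 5), G.Homotopic G' ∧ ∀ w, (G' (susp 3 w)).1 =
      reflMat (symProd (Quaternion.rot (q w.1) *ᵥ ![0, 0, 1])
        (Quaternion.rot (q w.1) *ᵥ ![-w.2, 1 - (w.2 : ℝ) ^ 2, 0])) *
      reflMat (symProd (Quaternion.rot (q w.1) *ᵥ ![0, 0, 1])
        (Quaternion.rot (q w.1) *ᵥ ![1, 0, 0])) := by
  have hR := fun x => Quaternion.irr_transpose_mul (hq x)
  have hirr : Continuous fun x => Quaternion.irr (q x) :=
    Quaternion.continuous_irr q.continuous hq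
  obtain ⟨G', hG, h1⟩ := exists_homotopic_of_isSO G
    (M := fun w => Quaternion.irr (q w.1.1) * twist w.2 (-w.1.2) (1 - (w.1.2 : ℝ) ^ 2) *
      (Quaternion.irr (q w.1.1))ᵀ)
    (((hirr.comp (by fun_prop)).mul (continuous_twist (by fun_prop) (by fun_prop) (by fun_prop)
      fun w => neg_height_sq_add_ne_zero _)).mul (hirr.comp (by fun_prop)).matrix_transpose)
    (fun w => ((isSO_irr (hq _)).mul (isSO_twist (neg_height_sq_add_ne_zero _) _)).mul
      (isSO_irr (hq _)).transpose)
    (fun s x x' => by simp [twist_end, mul_eq_one_comm.1 (hR _)])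
    (fun w => by
      have hne : (-w.2 : ℝ) • 1 + (1 - (w.2 : ℝ) ^ 2) • Quaternion.unitK ≠ 0 := fun h =>
        neg_height_sq_add_ne_zero w.2 (by
          have h1 := congrArg (fun q : ℍ[ℝ] => q.re) h
          have h2 := congrArg (fun q : ℍ[ℝ] => q.imK) h
          simp at h1 h2
          rw [h2, h1]
          norm_num)
      rw [h0, Quaternion.irr_mul (mul_ne_zero (hq _) hne) (inv_ne_zero (hq _)),
        Quaternion.irr_mul (hq _) hne, Quaternion.irr_inv (hq _)]
      simp [twist_zero (neg_height_sq_add_ne_zero _)])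
  refine ⟨G', hG, fun w => ?_⟩
  rw [h1]
  simp only [Set.Icc.coe_one]
  rw [twist_one (neg_height_sq_add_ne_zero _), mul_reflMat_mul_reflMat_mul_transpose (hR _),
    ← symProd_single, ← symProd_single, Quaternion.irr,
    rhoMat_mulVec_symProd (Quaternion.rot_transpose_mul_rot (hq _)) (by simp),
    rhoMat_mulVec_symProd (Quaternion.rot_transpose_mul_rot (hq _)) (by simp)]

lemma continuous_symProd : Continuous fun p : (Fin 3 → ℝ) × (Fin 3 → ℝ) => symProd p.1 p.2 := by
  simp only [symProd_apply]
  refine continuous_pi fun k => ?_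
  fin_cases k <;> simp <;> fun_prop

lemma continuous_triVec : Continuous triVec := by
  refine continuous_pi fun k => ?_
  fin_cases k <;> simp [triVec] <;> fun_prop

lemma exists_homotopic_const_of_symProd (G : C(Sph 4, SO 5))
    {h : Sph 3 → Matrix (Fin 3) (Fin 3) ℝ} (hc : Continuous h) (hh : ∀ x, (h x)ᵀ * h x = 1)
    (h0 : ∀ w, (G (susp 3 w)).1 =
      reflMat (symProd (h w.1 *ᵥ ![0, 0, 1]) (h w.1 *ᵥ ![-w.2, 1 - (w.2 : ℝ) ^ 2, 0])) *
      reflMat (symProd (h w.1 *ᵥ ![0, 0, 1]) (h w.1 *ᵥ ![1, 0, 0]))) :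
    ∃ y : SO 5, G.Homotopic (ContinuousMap.const _ y) := by
  have hneg : ∀ x (a : ℝ), h x *ᵥ ![-a, 0, 0] = -(h x *ᵥ ![a, 0, 0]) := fun x a => by
    rw [← mulVec_neg]
    simp
  have hvc : Continuous fun p : (Sph 3 × unitInterval) × ℝ × ℝ =>
      h p.1.1 *ᵥ ![p.2.1, p.2.2, 0] := by
    refine Continuous.matrix_mulVec (hc.comp (by fun_prop)) (continuous_pi fun k => ?_)
    fin_cases k <;> simp <;> fun_prop
  have htri : ∀ w, triVec (-w) = -triVec w := fun w => by
    ext k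
    fin_cases k <;> simp [triVec]
    ring
  have hsym : ∀ v w, symProd v (-w) = -symProd v w := fun v w => by
    rw [symProd_apply, symProd_apply]
    ext k
    fin_cases k <;> simp <;> ring
  obtain ⟨G₁, hG₁, h1⟩ := exists_homotopic_of_reflMat_pair G
    (V := fun y a b => (1 - (y.2 : ℝ)) • symProd (h y.1 *ᵥ ![0, 0, 1]) (h y.1 *ᵥ ![a, b, 0]) +
      (y.2 : ℝ) • triVec (h y.1 *ᵥ ![a, b, 0]))
    (((by fun_prop : Continuous fun p : (Sph 3 × unitInterval) × ℝ × ℝ =>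
      1 - (p.1.2 : ℝ)).smul (continuous_symProd.comp (Continuous.prodMk
        (Continuous.matrix_mulVec (hc.comp (by fun_prop)) continuous_const) hvc))).add
      ((by fun_prop : Continuous fun p : (Sph 3 × unitInterval) × ℝ × ℝ =>
        (p.1.2 : ℝ)).smul (continuous_triVec.comp hvc)))
    (fun y a b hab => symProd_add_triVec_ne_zero (hh _) hab _)
    (fun y a => by rw [hneg, hsym, htri]; module)
    (fun w => by simp [h0])
  obtain ⟨G₂, hG₂, h2⟩ := exists_homotopic_of_reflMat_pair G₁
    (V := fun y a b => (1 - (y.2 : ℝ)) • triVec (h y.1 *ᵥ ![a, b, 0]) +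
      (y.2 : ℝ) • ![0, a, b, 0, 0])
    (((by fun_prop : Continuous fun p : (Sph 3 × unitInterval) × ℝ × ℝ =>
      1 - (p.1.2 : ℝ)).smul (continuous_triVec.comp hvc)).add
      ((by fun_prop : Continuous fun p : (Sph 3 × unitInterval) × ℝ × ℝ =>
        (p.1.2 : ℝ)).smul (continuous_pi fun k => by fin_cases k <;> simp <;> fun_prop)))
    (fun y a b hab heq => by
      rcases eq_or_ne (y.2 : ℝ) 0 with hs | hs
      · rw [hs, sub_zero, one_smul, zero_smul, add_zero] at heq
        exact triVec_ne_zero (mulVec_ne_zero (hh _) (vec_ne_zero hab)) heq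
      · have ha := congrFun heq 1
        have hb := congrFun heq 2
        simp [triVec, hs] at ha hb
        simp [ha, hb] at hab)
    (fun y a => by
      rw [hneg, htri]
      have : ![0, -a, 0, 0, 0] = -![0, a, 0, 0, 0] := by simp
      rw [this]
      module)
    (fun w => by simp [h1])
  have hτ : Continuous fun w : (Sph 3 × Height) × unitInterval =>
      ![0, -((1 - (w.2 : ℝ)) * w.1.2), 1 - ((1 - (w.2 : ℝ)) * w.1.2) ^ 2, 0, 0] := by
    refine continuous_pi fun k => ?_
    fin_cases k <;> simp <;> fun_prop
  obtain ⟨G₃, hG₃, h3⟩ := exists_homotopic_of_isSO G₂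
    (M := fun w => reflMat ![0, -((1 - (w.2 : ℝ)) * w.1.2), 1 - ((1 - (w.2 : ℝ)) * w.1.2) ^ 2, 0, 0]
      * reflMat ![0, 1, 0, 0, 0])
    ((continuous_reflMat hτ fun w => plane_vec_ne_zero (neg_height_sq_add_ne_zero _)).mul
      continuous_const)
    (fun w => isSO_reflMat_mul_reflMat (plane_vec_ne_zero (neg_height_sq_add_ne_zero _))
      (plane_vec_ne_zero (by norm_num)))
    (fun s x x' => ⟨rfl, rfl⟩)
    (fun w => by simp [h2])
  refine ⟨⟨reflMat ![0, 0, 1, 0, 0] * reflMat ![0, 1, 0, 0, 0], isSO_reflMat_mul_reflMat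
    (plane_vec_ne_zero (by norm_num)) (plane_vec_ne_zero (by norm_num))⟩, ?_⟩
  convert ((hG₁.trans hG₂).trans hG₃) using 1
  ext y : 1
  obtain ⟨w, rfl⟩ := susp_surjective 3 y
  refine Subtype.ext ?_
  rw [h3]
  simp

lemma exists_unitI_mul_eq : ∃ p : ℍ[ℝ], p ≠ 0 ∧ Quaternion.unitI * p = p * Quaternion.unitK := by
  refine ⟨Quaternion.unitI + Quaternion.unitK, fun h => ?_, ?_⟩
  · simpa using congrArg (fun q : ℍ[ℝ] => q.imI) h
  · ext <;> simp

lemma exists_axis_form (F : C(Sph 4, NZ)) :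
    ∃ (G : C(Sph 4, NZ)) (q : C(Sph 3, ℍ[ℝ])), F.Homotopic G ∧ (∀ x, q x ≠ 0) ∧
      ∀ w, (G (susp 3 w)).1 = q w.1 *
        ((-w.2 : ℝ) • 1 + (1 - (w.2 : ℝ) ^ 2) • Quaternion.unitK) * (q w.1)⁻¹ := by
  obtain ⟨G, q, hG, hq, h⟩ := exists_conjugate_form F
  obtain ⟨p, hp, hpk⟩ := exists_unitI_mul_eq
  have hI : Quaternion.unitI = p * Quaternion.unitK * p⁻¹ := by
    rw [← hpk, mul_inv_cancel_right₀ hp]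
  refine ⟨G, ⟨fun x => q x * p, by fun_prop⟩, hG, fun x => mul_ne_zero (hq x) hp, fun w => ?_⟩
  have h1 : (1 - (w.2 : ℝ) ^ 2) • Quaternion.unitI - (w.2 : ℝ) • 1 =
      p * ((-w.2 : ℝ) • 1 + (1 - (w.2 : ℝ) ^ 2) • Quaternion.unitK) * p⁻¹ := by
    rw [hI, mul_add, add_mul, mul_smul_comm, mul_smul_comm, smul_mul_assoc, smul_mul_assoc, mul_one,
      mul_inv_cancel₀ hp]
    module
  rw [h, h1]
  simp only [ContinuousMap.coe_mk, _root_.mul_inv_rev, mul_assoc]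

/-- The homomorphism `π₄(SO(3)) → π₄(SO(5))` induced by the irreducible embedding is
trivial: for every continuous `f : S⁴ → SO(3)`, the composition `ρ ∘ f` (i.e. any
continuous map `g : S⁴ → SO(5)` whose values are `ρ (f x)`) is null-homotopic. -/
theorem irr_embedding_comp_nullhomotopic (f : C(S4, SO 3)) (g : C(S4, SO 5))
    (hg : ∀ x : S4, (g x).val = rhoMat (f x).val) :
    ∃ y : SO 5, ContinuousMap.Homotopic g (ContinuousMap.const S4 y) := by
  obtain ⟨F, hF, hFf⟩ := Quaternion.exists_lift_rot f
  have hF0 : ∀ x, F x ≠ 0 := fun x h => by simpa [h] using hF x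
  obtain ⟨G, q, hG, hq, h⟩ := exists_axis_form ⟨fun x => ⟨F x, hF0 x⟩, by fun_prop⟩
  let Φ : C(NZ, SO 5) := ⟨fun p => ⟨Quaternion.irr p.1, isSO_irr p.2⟩,
    (Quaternion.continuous_irr continuous_subtype_val fun p => p.2).subtype_mk _⟩
  obtain ⟨G', hG', h'⟩ := exists_homotopic_symProd (Φ.comp G) q hq
    (fun w => congrArg Quaternion.irr (h w))
  obtain ⟨y, hy⟩ := exists_homotopic_const_of_symProd G'
    (Quaternion.continuousOn_rot.comp_continuous q.continuous hq)
    (fun x => Quaternion.rot_transpose_mul_rot (hq x)) h'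
  refine ⟨y, ?_⟩
  convert (((ContinuousMap.Homotopic.refl Φ).comp hG).trans hG').trans hy using 1
  ext x : 1
  refine Subtype.ext ?_
  rw [hg, ← hFf]
  rfl
end

section
/- For all real numbers α, β, γ > 0, there exists a real number a satisfying both a + 2/√α = 2√α/(5β) and 2a − 1/√α = −√α/(5γ) if and only if αβ + 4αγ − 25βγ = 0. (This is the condition for the homogeneous metric g_{αβγ} on the twisted Stiefel manifold V^{ir}_{2,4} = SO(3)×SO(3)/SO(2)_{ir} to define a nearly integrable SO(3)_{ir} structure admitting a characteristic connection.) -/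
/-- For `α, β, γ > 0`, there exists `a ∈ ℝ` with `a + 2/√α = 2√α/(5β)` and
`2a − 1/√α = −√α/(5γ)` if and only if `αβ + 4αγ − 25βγ = 0`: the condition for the
metric `g_{αβγ}` on the twisted Stiefel manifold to define a nearly integrable
`SO(3)_ir` structure. -/
theorem nearly_integrable_condition_twisted_stiefel
    (α β γ : ℝ) (hα : 0 < α) (hβ : 0 < β) (hγ : 0 < γ) :
    (∃ a : ℝ, a + 2 / Real.sqrt α = 2 * Real.sqrt α / (5 * β) ∧
        2 * a - 1 / Real.sqrt α = -(Real.sqrt α / (5 * γ)))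
      ↔ α * β + 4 * α * γ - 25 * β * γ = 0 := by
  obtain ⟨s, hs, rfl⟩ : ∃ s : ℝ, 0 < s ∧ α = s ^ 2 :=
    ⟨√α, Real.sqrt_pos.2 hα, (Real.sq_sqrt hα.le).symm⟩
  rw [Real.sqrt_sq hs.le]
  have key : 2 * (2 * s / (5 * β) - 2 / s) - 1 / s + s / (5 * γ) =
      (s ^ 2 * β + 4 * s ^ 2 * γ - 25 * β * γ) / (5 * s * β * γ) := by
    field_simp
    ring
  have hne : 5 * s * β * γ ≠ 0 := by positivity
  simp only [← eq_sub_iff_add_eq, exists_eq_left]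
  rw [eq_neg_iff_add_eq_zero, key, div_eq_zero_iff, or_iff_left hne]
end

section
/- There exist real numbers κ, β, γ with β > 0, γ > 0 and 0 < κ < 25/8 satisfying the three equations κ = 1/β − 2/(25β²), κ = 1/γ − 1/(50γ²), and κ = 2/(25β²) + 1/(50γ²); moreover any solution of these equations satisfies κ = (5 + √(25 − 8κ))/(10κ)-type relations, namely β = (5 ± √(25 − 8κ))/(10κ) and γ = (5 ± √(25 − 2κ))/(10κ), and no solution has κ = 0. (This establishes the existence of a homogeneous Einstein metric g_{1βγ}, which is not Ricci-flat, on the twisted Stiefel manifold V^{ir}_{2,4}.) -/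
/-- Completing the square: the quadratic formula for `x` in terms of `κ`. -/
theorem eq_add_sqrt_or_eq_sub_sqrt {κ x d : ℝ} (hκ : κ ≠ 0) (h : (10 * κ * x - 5) ^ 2 = d) :
    x = (5 + Real.sqrt d) / (10 * κ) ∨ x = (5 - Real.sqrt d) / (10 * κ) := by
  have h10 : 10 * κ ≠ 0 := mul_ne_zero (by norm_num) hκ
  have hs : Real.sqrt d = |10 * κ * x - 5| := by rw [← h, Real.sqrt_sq_eq_abs]
  rw [hs, eq_div_iff h10, eq_div_iff h10]
  rcases abs_choice (10 * κ * x - 5) with h' | h' <;> rw [h']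
  · left; ring
  · right; ring

/-- The cubic obtained from the Einstein equations for `c = 1 / γ`, after eliminating `1 / β`,
has a root in `[3, 3.345]`. -/
theorem exists_root_einstein_cubic :
    ∃ c : ℝ, 3 ≤ c ∧ c ≤ 669 / 200 ∧ 2 * c * (2 - 3 * c / 50) ^ 2 = 25 - c := by
  have hcont : ContinuousOn (fun c : ℝ => 2 * c * (2 - 3 * c / 50) ^ 2 - (25 - c))
      (Set.Icc 3 (669 / 200)) := by fun_prop
  obtain ⟨c, ⟨h1, h2⟩, hc⟩ := intermediate_value_Icc (by norm_num) hcont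
    (show (0 : ℝ) ∈ Set.Icc _ _ by constructor <;> norm_num)
  exact ⟨c, h1, h2, sub_eq_zero.mp hc⟩

/-- The Einstein condition for the metrics `g_{1βγ}` on the twisted Stiefel manifold
`V^{ir}_{2,4}`: there is a solution `(κ, β, γ)` with `β, γ > 0` and `0 < κ < 25/8`;
moreover every solution with `β, γ > 0` has `κ ≠ 0`,
`β = (5 ± √(25 − 8κ))/(10κ)` and `γ = (5 ± √(25 − 2κ))/(10κ)`. -/
theorem einstein_metric_twisted_stiefel :
    (∃ κ β γ : ℝ, 0 < β ∧ 0 < γ ∧ 0 < κ ∧ κ < 25 / 8 ∧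
      κ = 1 / β - 2 / (25 * β ^ 2) ∧
      κ = 1 / γ - 1 / (50 * γ ^ 2) ∧
      κ = 2 / (25 * β ^ 2) + 1 / (50 * γ ^ 2)) ∧
    (∀ κ β γ : ℝ, 0 < β → 0 < γ →
      κ = 1 / β - 2 / (25 * β ^ 2) →
      κ = 1 / γ - 1 / (50 * γ ^ 2) →
      κ = 2 / (25 * β ^ 2) + 1 / (50 * γ ^ 2) →
      κ ≠ 0 ∧
      (β = (5 + Real.sqrt (25 - 8 * κ)) / (10 * κ) ∨
        β = (5 - Real.sqrt (25 - 8 * κ)) / (10 * κ)) ∧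
      (γ = (5 + Real.sqrt (25 - 2 * κ)) / (10 * κ) ∨
        γ = (5 - Real.sqrt (25 - 2 * κ)) / (10 * κ))) := by
  constructor
  · obtain ⟨c, hc3, hc, hroot⟩ := exists_root_einstein_cubic
    have hc0 : 0 < c := by linarith
    set b : ℝ := c * (2 - 3 * c / 50) with hb
    have hb0 : 0 < b := mul_pos hc0 (by linarith)
    have hsq : 2 * b ^ 2 = 25 * c - c ^ 2 := by
      rw [hb]; linear_combination c * hroot
    refine ⟨c - c ^ 2 / 50, 1 / b, 1 / c, by positivity, by positivity, ?_, ?_, ?_, ?_, ?_⟩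
    · nlinarith
    · nlinarith
    · have h : c - c ^ 2 / 50 = b - 2 * b ^ 2 / 25 := by
        linear_combination -hb + hsq / 25
      rw [h]; field_simp
    · field_simp
    · have h : c - c ^ 2 / 50 = 2 * b ^ 2 / 25 + c ^ 2 / 50 := by
        linear_combination -hsq / 25
      rw [h]; field_simp
  · intro κ β γ hβ hγ h1 h2 h3
    have hκ : κ ≠ 0 := by rw [h3]; positivity
    refine ⟨hκ, eq_add_sqrt_or_eq_sub_sqrt hκ ?_, eq_add_sqrt_or_eq_sub_sqrt hκ ?_⟩
    · have h : 25 * κ * β ^ 2 - 25 * β + 2 = 0 := by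
        rw [h1]; field_simp; ring
      linear_combination 4 * κ * h
    · have h : 50 * κ * γ ^ 2 - 50 * γ + 1 = 0 := by
        rw [h2]; field_simp; ring
      linear_combination 2 * κ * h
end
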